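/- arXiv:2510.14568 — 5 statements merged into one kernel-verified Lean document; each statement's English description precedes it below -/
import Mathlib

section
/- Let G be a finite group, let F be an injective group cellular automaton on G, and fix k ∈ ℤ. Then F is expansive if and only if both of the following hold: (1) for every c ∈ L(k) there exists n ∈ ℤ such that F^n(c)_j ≠ e for some j > k; and (2) for every c ∈ R(k) there exists n ∈ ℤ such that F^n(c)_j ≠ e for some j < k. -/
open Function Topology

/-- The prodiscrete (product of discrete) topology on configurations `ℤ → A`. -/
def configTop (A : Type*) : TopologicalSpace (ℤ → A) :=
  @Pi.topologicalSpace ℤ (fun _ => A) (fun _ => ⊥)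

/-- The shift map. -/
def shiftMap (A : Type*) : (ℤ → A) → (ℤ → A) := fun c i => c (i + 1)

open Classical in
/-- The Tychonoff distance on configurations. -/
noncomputable def tychDist {A : Type*} (c c' : ℤ → A) : ℝ :=
  if c = c' then 0
  else (2 : ℝ) ^ (-((sInf {n : ℕ | ∃ j : ℤ, j.natAbs = n ∧ c j ≠ c' j} : ℕ) : ℤ))

/-- The `n`-th iterate, `n ∈ ℤ`, of a map (negative powers via `Function.invFun`,
which is the genuine inverse whenever the map is bijective). -/
noncomputable def zIter {A : Type*} [Nonempty A] (F : (ℤ → A) → (ℤ → A)) (n : ℤ) :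
    (ℤ → A) → (ℤ → A) :=
  if 0 ≤ n then F^[n.toNat] else (Function.invFun F)^[(-n).toNat]

/-- Expansivity (for reversible maps). -/
def Expansive {A : Type*} [Nonempty A] (F : (ℤ → A) → (ℤ → A)) : Prop :=
  ∃ ε : ℝ, 0 < ε ∧ ∀ c c' : ℤ → A, c ≠ c' →
    ∃ n : ℤ, tychDist (zIter F n c) (zIter F n c') > ε

/-- Positive expansivity. -/
def PosExpansive {A : Type*} (F : (ℤ → A) → (ℤ → A)) : Prop :=
  ∃ ε : ℝ, 0 < ε ∧ ∀ c c' : ℤ → A, c ≠ c' →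
    ∃ n : ℕ, tychDist (F^[n] c) (F^[n] c') > ε

/-- Topological transitivity (w.r.t. the prodiscrete topology). -/
def TopTransitive {A : Type*} (F : (ℤ → A) → (ℤ → A)) : Prop :=
  ∀ U V : Set (ℤ → A), IsOpen[configTop A] U → IsOpen[configTop A] V →
    U.Nonempty → V.Nonempty → ∃ n : ℕ, (F^[n] '' U ∩ V).Nonempty

/-- Left fronts. -/
def Lset (G : Type*) [One G] (k : ℤ) : Set (ℤ → G) := {c | c k ≠ 1 ∧ ∀ i > k, c i = 1}

/-- Right fronts. -/
def Rset (G : Type*) [One G] (k : ℤ) : Set (ℤ → G) := {c | c k ≠ 1 ∧ ∀ i < k, c i = 1}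

/-- The position of a front: the largest index where it differs from the identity. -/
noncomputable def pos {G : Type*} [One G] (c : ℤ → G) : ℤ := sSup {j : ℤ | c j ≠ 1}

/-- `kF` is an expansivity constant for `F`. -/
def ExpConstant {G : Type*} [Group G] (F : (ℤ → G) → (ℤ → G)) (kF : ℕ) : Prop :=
  0 < kF ∧ ∀ k : ℤ,
    (∀ c ∈ Lset G k, ∃ n : ℤ, n.natAbs ≤ kF ∧ pos (zIter F n c) > k) ∧
    (∀ c ∈ Rset G k, ∃ n : ℤ, n.natAbs ≤ kF ∧ ∃ j < k, zIter F n c j ≠ 1)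

/-- `ρ` is a radius of `F`. -/
def IsRadius {A : Type*} (F : (ℤ → A) → (ℤ → A)) (ρ : ℕ) : Prop :=
  ∀ c c' : ℤ → A, ∀ i : ℤ, (∀ j : ℤ, |j - i| ≤ (ρ : ℤ) → c j = c' j) → F c i = F c' i

theorem zpow_lt_tychDist_iff {A : Type*} (c c' : ℤ → A) (m : ℕ) :
    tychDist c c' > (2 : ℝ) ^ (-(m : ℤ)) ↔ ∃ j : ℤ, j.natAbs < m ∧ c j ≠ c' j := by
  unfold tychDist
  split_ifs with h
  · subst h
    simp
  · have hne : {n : ℕ | ∃ j : ℤ, j.natAbs = n ∧ c j ≠ c' j}.Nonempty := by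
      obtain ⟨j, hj⟩ := Function.ne_iff.1 h
      exact ⟨_, j, rfl, hj⟩
    rw [gt_iff_lt, zpow_lt_zpow_iff_right₀ (by norm_num), neg_lt_neg_iff, Nat.cast_lt]
    constructor
    · intro hlt
      obtain ⟨j, hj, hjc⟩ := Nat.sInf_mem hne
      exact ⟨j, hj ▸ hlt, hjc⟩
    · rintro ⟨j, hj, hjc⟩
      have hmem : j.natAbs ∈ {n : ℕ | ∃ j : ℤ, j.natAbs = n ∧ c j ≠ c' j} := ⟨j, rfl, hjc⟩
      exact (Nat.sInf_le hmem).trans_lt hj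

theorem expansive_iff_exists_window {A : Type*} [Nonempty A] (F : (ℤ → A) → (ℤ → A)) :
    Expansive F ↔ ∃ m : ℕ, ∀ c c' : ℤ → A, c ≠ c' →
      ∃ n j : ℤ, j.natAbs < m ∧ zIter F n c j ≠ zIter F n c' j := by
  constructor
  · rintro ⟨ε, hε, h⟩
    obtain ⟨m, hm⟩ := exists_pow_lt_of_lt_one hε (by norm_num : (2⁻¹ : ℝ) < 1)
    refine ⟨m, fun c c' hcc => ?_⟩
    obtain ⟨n, hn⟩ := h c c' hcc
    refine ⟨n, (zpow_lt_tychDist_iff _ _ m).1 (lt_trans ?_ hn)⟩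
    simpa [zpow_neg] using hm
  · rintro ⟨m, h⟩
    refine ⟨2 ^ (-(m : ℤ)), by positivity, fun c c' hcc => ?_⟩
    obtain ⟨n, hn⟩ := h c c' hcc
    exact ⟨n, (zpow_lt_tychDist_iff _ _ m).2 hn⟩

theorem map_translate_of_comp_shiftMap {A : Type*} {F : (ℤ → A) → (ℤ → A)}
    (hshift : F ∘ shiftMap A = shiftMap A ∘ F) (n : ℤ) (c : ℤ → A) :
    F (fun i => c (i + n)) = fun i => F c (i + n) := by
  have hs : ∀ c : ℤ → A, F (fun i => c (i + 1)) = fun i => F c (i + 1) :=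
    fun c => congrFun hshift c
  induction n generalizing c with
  | zero => simp
  | succ n ih =>
    have := hs (fun i => c (i + n))
    rw [ih] at this
    simpa [add_assoc, add_comm, add_left_comm] using this
  | pred n ih =>
    have := hs (fun i => c (i + (-n - 1)))
    have h2 : (fun i : ℤ => c (i + 1 + (-n - 1))) = fun i => c (i + -n) := by
      funext i; congr 1; ring
    rw [h2, ih] at this
    funext i
    have := congrFun this (i - 1)
    simp only [sub_add_cancel] at this
    rw [← this]
    congr 1; ring

theorem surjective_of_injective_of_comp_shiftMap {A : Type*} [Finite A] {F : (ℤ → A) → (ℤ → A)}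
    (hcont : Continuous[configTop A, configTop A] F)
    (hshift : F ∘ shiftMap A = shiftMap A ∘ F) (hinj : Function.Injective F) :
    Function.Surjective F := by
  let _ : TopologicalSpace A := ⊥
  have : DiscreteTopology A := ⟨rfl⟩
  have hF : Continuous F := hcont
  have hclosed : IsClosed (Set.range F) := (isCompact_range hF).isClosed
  intro d
  rw [← Set.mem_range, ← hclosed.closure_eq, mem_closure_iff]
  intro U hU hdU
  obtain ⟨I, u, hu, hIU⟩ := isOpen_pi_iff.1 hU d hdU
  obtain ⟨N, hN⟩ : ∃ N : ℕ, ∀ i ∈ I, i.natAbs ≤ N :=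
    ⟨I.sup Int.natAbs, fun i hi => Finset.le_sup (f := Int.natAbs) hi⟩
  let P : ℤ := 2 * N + 1
  have hP : 0 < P := by positivity
  let T : Set (ℤ → A) := {c | (fun i => c (i + P)) = c}
  have hT : ∀ c ∈ T, ∀ i, c i = c (i % P) := by
    intro c hc i
    have hper : Function.Periodic c P := fun i => congrFun hc i
    conv_lhs => rw [← Int.emod_add_mul_ediv i P, mul_comm]
    exact hper.int_mul (i / P) (i % P)
  have hfin : Finite T := by
    refine Finite.of_injective
      (fun (c : T) (i : Set.Ico 0 P) => c.1 i.1) fun c c' h => Subtype.ext (funext fun i => ?_)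
    rw [hT c.1 c.2 i, hT c'.1 c'.2 i]
    exact congrFun h ⟨i % P, Int.emod_nonneg i hP.ne', Int.emod_lt_of_pos i hP⟩
  have hmaps : Set.MapsTo F T T := by
    intro c hc
    change (fun i => F c (i + P)) = F c
    rw [← map_translate_of_comp_shiftMap hshift P c, show (fun i => c (i + P)) = c from hc]
  have hsurj : Function.Surjective (hmaps.restrict F T T) :=
    Finite.injective_iff_surjective.1 (hmaps.restrict_inj.2 hinj.injOn)
  let p : ℤ → A := fun i => d ((i + N) % P - N)
  have hp : p ∈ T := by
    funext i
    change d ((i + P + N) % P - N) = d ((i + N) % P - N)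
    rw [show i + P + N = i + N + P by ring, Int.add_emod_right]
  obtain ⟨c, hc⟩ := hsurj ⟨p, hp⟩
  have hc' : F c.1 = p := congrArg Subtype.val hc
  refine ⟨p, hIU fun i hi => ?_, c.1, hc'⟩
  have hi' := hN i hi
  have : p i = d i := by
    change d ((i + N) % P - N) = d i
    rw [Int.emod_eq_of_lt (by lia) (by lia), add_sub_cancel_right]
  rw [this]
  exact (hu i hi).2

theorem exists_radius_of_continuous {G : Type*} [Group G] {F : (ℤ → G) → (ℤ → G)}
    (hcont : Continuous[configTop G, configTop G] F)
    (hshift : F ∘ shiftMap G = shiftMap G ∘ F) (hone : F 1 = 1) :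
    ∃ r : ℕ, ∀ (c : ℤ → G) (i : ℤ), (∀ j, |j - i| ≤ r → c j = 1) → F c i = 1 := by
  let _ : TopologicalSpace G := ⊥
  have : DiscreteTopology G := ⟨rfl⟩
  have hF : Continuous F := hcont
  have hU : IsOpen {c : ℤ → G | F c 0 = 1} :=
    (isOpen_discrete {(1 : G)}).preimage ((continuous_apply 0).comp hF)
  obtain ⟨I, u, hu, hIU⟩ := isOpen_pi_iff.1 hU 1 (by simp [hone])
  refine ⟨I.sup Int.natAbs, fun c i hc => ?_⟩
  have key : (fun j => c (j + i)) ∈ {c : ℤ → G | F c 0 = 1} := by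
    refine hIU fun j hj => ?_
    have h1 : j.natAbs ≤ I.sup Int.natAbs := Finset.le_sup (f := Int.natAbs) hj
    have : c (j + i) = 1 := hc _ (by
      rw [add_sub_cancel_right, Int.abs_eq_natAbs]; lia)
    simpa [this] using (hu j hj).2
  rw [Set.mem_ofPred_eq, map_translate_of_comp_shiftMap hshift] at key
  simpa using key

theorem zIter_mulAut {G : Type*} [Group G] (E : MulAut (ℤ → G)) (n : ℤ) :
    zIter E n = ⇑(E ^ n) := by
  have hinv : Function.invFun E = ⇑E⁻¹ := by
    funext c
    apply E.injective
    rw [Function.rightInverse_invFun E.surjective c, MulAut.apply_inv_self]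
  have hiter : ∀ (D : MulAut (ℤ → G)) (m : ℕ), (⇑D)^[m] = ⇑(D ^ m) := by
    intro D m
    induction m with
    | zero => rfl
    | succ m ih => rw [Function.iterate_succ, ih, pow_succ]; rfl
  unfold zIter
  split_ifs with h
  · lift n to ℕ using h
    rw [hiter, Int.toNat_natCast, zpow_natCast]
  · obtain ⟨m, rfl⟩ : ∃ m : ℕ, n = -m := ⟨(-n).toNat, by lia⟩
    rw [hinv, hiter, neg_neg, Int.toNat_natCast, zpow_neg, zpow_natCast, inv_pow]

/-- The automorphism of `ℤ → G` permuting the cells. -/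
def permCells (G : Type*) [Group G] (e : Equiv.Perm ℤ) : MulAut (ℤ → G) where
  toFun c i := c (e i)
  invFun c i := c (e.symm i)
  left_inv c := by simp
  right_inv c := by simp
  map_mul' _ _ := rfl

/-- If no left front is confined, a configuration whose orbit vanishes on a window wider than
the radius vanishes to the left of it. -/
theorem eq_one_of_neg_of_window {G : Type*} [Group G] (E : MulAut (ℤ → G)) (r : ℕ)
    (hr : ∀ (c : ℤ → G) (i : ℤ), (∀ j, |j - i| ≤ r → c j = 1) → E c i = 1)
    (hL : ∀ p : ℤ, ∀ c ∈ Lset G p, ∃ n : ℤ, ∃ j > p, (E ^ n) c j ≠ 1)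
    (c : ℤ → G) (hc : ∀ n j : ℤ, |j| ≤ r → (E ^ n) c j = 1) (j : ℤ) (hj : j ≤ 0) :
    c j = 1 := by
  let cut : (ℤ → G) → (ℤ → G) := fun c i => if i ≤ 0 then c i else 1
  have hstep : ∀ d : ℤ → G, (∀ j : ℤ, |j| ≤ r → d j = 1) → (∀ j : ℤ, |j| ≤ r → E d j = 1) →
      E (cut d) = cut (E d) := by
    intro d hd hEd
    funext i
    by_cases hi : i ≤ 0
    · have : E (cut d * d⁻¹) i = 1 := by
        refine hr _ _ fun j hj => ?_
        rw [abs_le] at hj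
        by_cases hj0 : j ≤ 0
        · simp [cut, hj0]
        · simp [cut, hj0, hd j (abs_le.2 ⟨by lia, by lia⟩)]
      rw [map_mul, map_inv, Pi.mul_apply, Pi.inv_apply, mul_inv_eq_one] at this
      rw [this]
      simp [cut, hi]
    · have : E (cut d) i = 1 := by
        refine hr _ _ fun j hj => ?_
        rw [abs_le] at hj
        by_cases hj0 : j ≤ 0
        · simp [cut, hj0, hd j (abs_le.2 ⟨by lia, by lia⟩)]
        · simp [cut, hj0]
      rw [this]
      simp [cut, hi]
  have hsucc : ∀ n : ℤ, E (cut ((E ^ n) c)) = cut ((E ^ (n + 1)) c) := by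
    intro n
    have h : (E ^ (n + 1)) c = E ((E ^ n) c) := by rw [add_comm, zpow_one_add]; rfl
    rw [h]
    exact hstep _ (hc n) (by simpa [h] using hc (n + 1))
  have hcut : ∀ n : ℤ, (E ^ n) (cut c) = cut ((E ^ n) c) := by
    intro n
    induction n with
    | zero => simp
    | succ n ih =>
      rw [← hsucc, ← ih, add_comm, zpow_one_add]; rfl
    | pred n ih =>
      apply E.injective
      rw [hsucc, sub_add_cancel, ← ih]
      have h : E ^ (-(n : ℤ)) = E * E ^ (-(n : ℤ) - 1) := by
        rw [← zpow_one_add, add_sub_cancel]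
      rw [h]
      rfl
  by_contra hne
  obtain ⟨p, ⟨n, hp⟩, hmax⟩ := Int.exists_greatest_of_bdd
    (P := fun p => ∃ n : ℤ, cut ((E ^ n) c) p ≠ 1)
    ⟨0, by
      rintro p ⟨n, hp⟩
      by_contra h
      exact hp (by simp only [cut, if_neg h])⟩
    ⟨j, 0, by simpa [cut, hj] using hne⟩
  obtain ⟨m, q, hq, hmq⟩ := hL p (cut ((E ^ n) c))
    ⟨hp, fun i hi => by_contra fun h => (hmax i ⟨n, h⟩).not_gt hi⟩
  refine (hmax q ⟨m + n, ?_⟩).not_gt hq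
  rw [← hcut, zpow_add, MulAut.mul_apply, hcut]
  exact hmq

/-- If no right front is confined, a configuration whose orbit vanishes on a window wider than
the radius vanishes to the right of it. -/
theorem eq_one_of_pos_of_window {G : Type*} [Group G] (E : MulAut (ℤ → G)) (r : ℕ)
    (hr : ∀ (c : ℤ → G) (i : ℤ), (∀ j, |j - i| ≤ r → c j = 1) → E c i = 1)
    (hR : ∀ p : ℤ, ∀ c ∈ Rset G p, ∃ n : ℤ, ∃ j < p, (E ^ n) c j ≠ 1)
    (c : ℤ → G) (hc : ∀ n j : ℤ, |j| ≤ r → (E ^ n) c j = 1) (j : ℤ) (hj : 0 ≤ j) :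
    c j = 1 := by
  let ρ : MulAut (ℤ → G) := permCells G (Equiv.neg ℤ)
  have hpow : ∀ (n : ℤ) (d : ℤ → G) (i : ℤ),
      ((ρ * E * ρ⁻¹) ^ n) d i = (E ^ n) (fun i => d (-i)) (-i) := by
    intro n d i
    rw [conj_zpow]
    rfl
  have := eq_one_of_neg_of_window (ρ * E * ρ⁻¹) r (fun d i hd => ?_) (fun p d hd => ?_)
    (fun i => c (-i)) (fun n i hi => ?_) (-j) (by lia)
  · simpa using this
  · refine hr (fun i => d (-i)) (-i) fun l hl => hd _ ?_
    rwa [← abs_neg, show -(-l - i) = l - -i by ring]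
  · obtain ⟨n, i, hi, hne⟩ := hR (-p) (fun i => d (-i))
      ⟨by simpa using hd.1, fun i hi => hd.2 _ (by lia)⟩
    exact ⟨n, -i, by lia, by rwa [hpow, neg_neg]⟩
  · rw [hpow]
    simpa using hc n (-i) (by rwa [abs_neg])

theorem zpow_apply_translate {G : Type*} [Group G] {E : MulAut (ℤ → G)}
    (hshift : ⇑E ∘ shiftMap G = shiftMap G ∘ ⇑E) (n s : ℤ) (c : ℤ → G) :
    (E ^ n) (fun i => c (i + s)) = fun i => (E ^ n) c (i + s) := by
  have hcomm : Commute E (permCells G (Equiv.addRight s)) :=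
    MulEquiv.ext fun c => map_translate_of_comp_shiftMap hshift s c
  exact DFunLike.congr_fun (hcomm.zpow_left n).eq c

/-- an injective GCA is expansive iff every left front eventually develops a
nonidentity value to the right of `k`, and symmetrically for right fronts. -/
theorem expansive_iff_fronts {G : Type*} [Group G] [Fintype G]
    (F : (ℤ → G) → (ℤ → G))
    (hcont : Continuous[configTop G, configTop G] F)
    (hshift : F ∘ shiftMap G = shiftMap G ∘ F)
    (hhom : ∀ c c' : ℤ → G, F (c * c') = F c * F c')
    (hinj : Function.Injective F) (k : ℤ) :
    Expansive F ↔
      ((∀ c ∈ Lset G k, ∃ n : ℤ, ∃ j > k, zIter F n c j ≠ 1) ∧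
       (∀ c ∈ Rset G k, ∃ n : ℤ, ∃ j < k, zIter F n c j ≠ 1)) := by
  have hone : F 1 = 1 := by simpa using hhom 1 1
  have hsurj := surjective_of_injective_of_comp_shiftMap hcont hshift hinj
  obtain ⟨r, hr⟩ := exists_radius_of_continuous hcont hshift hone
  obtain ⟨E, rfl⟩ : ∃ E : MulAut (ℤ → G), ⇑E = F :=
    ⟨MulEquiv.ofBijective (MulHom.mk F hhom) ⟨hinj, hsurj⟩, rfl⟩
  rw [expansive_iff_exists_window]
  simp only [zIter_mulAut]
  have htr := zpow_apply_translate hshift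
  constructor
  · rintro ⟨m, hm⟩
    refine ⟨fun c hc => ?_, fun c hc => ?_⟩
    · obtain ⟨n, j, hj, hne⟩ := hm (fun i => c (i + (k + m))) 1
        (Function.ne_iff.2 ⟨-m, by simpa using hc.1⟩)
      rw [htr, map_one] at hne
      exact ⟨n, j + (k + m), by lia, hne⟩
    · obtain ⟨n, j, hj, hne⟩ := hm (fun i => c (i + (k - m))) 1
        (Function.ne_iff.2 ⟨m, by simpa using hc.1⟩)
      rw [htr, map_one] at hne
      exact ⟨n, j + (k - m), by lia, hne⟩
  · rintro ⟨hL, hR⟩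
    have hL' : ∀ p : ℤ, ∀ c ∈ Lset G p, ∃ n : ℤ, ∃ j > p, (E ^ n) c j ≠ 1 := by
      intro p c hc
      obtain ⟨n, j, hj, hne⟩ := hL (fun i => c (i + (p - k)))
        ⟨by simpa using hc.1, fun i hi => hc.2 _ (by lia)⟩
      rw [htr] at hne
      exact ⟨n, j + (p - k), by lia, hne⟩
    have hR' : ∀ p : ℤ, ∀ c ∈ Rset G p, ∃ n : ℤ, ∃ j < p, (E ^ n) c j ≠ 1 := by
      intro p c hc
      obtain ⟨n, j, hj, hne⟩ := hR (fun i => c (i + (p - k)))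
        ⟨by simpa using hc.1, fun i hi => hc.2 _ (by lia)⟩
      rw [htr] at hne
      exact ⟨n, j + (p - k), by lia, hne⟩
    refine ⟨r + 1, fun c c' hcc => ?_⟩
    by_contra! hwin
    have hz : ∀ n j : ℤ, |j| ≤ r → (E ^ n) (c * c'⁻¹) j = 1 := by
      intro n j hj
      rw [map_mul, map_inv, Pi.mul_apply, Pi.inv_apply, mul_inv_eq_one]
      exact hwin n j (by rw [Int.abs_eq_natAbs] at hj; lia)
    refine hcc (mul_inv_eq_one.1 (funext fun j => ?_))
    rcases le_total j 0 with hj | hj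
    · exact eq_one_of_neg_of_window E r hr hL' _ hz j hj
    · exact eq_one_of_pos_of_window E r hr hR' _ hz j hj
end

section
/- Let G be a finite group, let F be a (not necessarily injective) group cellular automaton on G, and fix k ∈ ℤ. Then F is positively expansive if and only if both of the following hold: (1) for every c ∈ L(k) there exists a positive integer n such that F^n(c)_j ≠ e for some j > k; and (2) for every c ∈ R(k) there exists a positive integer n such that F^n(c)_j ≠ e for some j < k. -/
open Function Topology

/-- Translation of configurations by an arbitrary integer. -/
def translateBy {A : Type*} (m : ℤ) (c : ℤ → A) : ℤ → A := fun i => c (i + m)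

theorem translateBy_zero {A : Type*} (c : ℤ → A) : translateBy 0 c = c := by
  funext i
  rw [translateBy, add_zero]

theorem translateBy_translateBy {A : Type*} (m n : ℤ) (c : ℤ → A) :
    translateBy m (translateBy n c) = translateBy (m + n) c := by
  funext i
  simp only [translateBy, add_assoc]

theorem translateBy_one_injective {A : Type*} :
    Injective (translateBy 1 : (ℤ → A) → (ℤ → A)) := by
  intro c c' h
  funext i
  simpa [translateBy] using congrFun h (i - 1)

theorem commute_translateBy {A : Type*} {F : (ℤ → A) → (ℤ → A)}
    (hshift : F ∘ shiftMap A = shiftMap A ∘ F) (m : ℤ) :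
    Function.Commute F (translateBy m) := by
  have hone : ∀ c, F (translateBy 1 c) = translateBy 1 (F c) := fun c => congrFun hshift c
  induction m with
  | zero =>
    intro c
    rw [translateBy_zero, translateBy_zero]
  | succ n ih =>
    intro c
    rw [add_comm, ← translateBy_translateBy, hone, ih c, translateBy_translateBy]
  | pred n ih =>
    intro c
    apply translateBy_one_injective
    rw [← hone, translateBy_translateBy, translateBy_translateBy]
    simpa using ih c

theorem tychDist_le {A : Type*} {c c' : ℤ → A} {M : ℕ}
    (h : ∀ j : ℤ, j.natAbs < M → c j = c' j) : tychDist c c' ≤ (2 : ℝ) ^ (-(M : ℤ)) := by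
  unfold tychDist
  split_ifs with hc
  · positivity
  · apply zpow_le_zpow_right₀ one_le_two
    obtain ⟨i, hi⟩ := Function.ne_iff.mp hc
    have hM : M ≤ sInf {n : ℕ | ∃ j : ℤ, j.natAbs = n ∧ c j ≠ c' j} := by
      refine le_csInf ⟨_, i, rfl, hi⟩ ?_
      rintro _ ⟨j, rfl, hj⟩
      by_contra! hlt
      exact hj (h j hlt)
    lia

theorem le_tychDist {A : Type*} {c c' : ℤ → A} {j : ℤ} (h : c j ≠ c' j) :
    (2 : ℝ) ^ (-(j.natAbs : ℤ)) ≤ tychDist c c' := by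
  have hc : c ≠ c' := fun hc => h (congrFun hc j)
  rw [tychDist, if_neg hc]
  apply zpow_le_zpow_right₀ one_le_two
  have : sInf {n : ℕ | ∃ j : ℤ, j.natAbs = n ∧ c j ≠ c' j} ≤ j.natAbs := Nat.sInf_le ⟨j, rfl, h⟩
  lia

theorem exists_iterate_ne_of_posExpansive {A : Type*} [One A] {F : (ℤ → A) → (ℤ → A)}
    (hshift : F ∘ shiftMap A = shiftMap A ∘ F) (hone : F 1 = 1) (hF : PosExpansive F)
    {s : ℤ} (hs : s * s = 1) {k : ℤ} {c : ℤ → A} (hc : c k ≠ 1) :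
    ∃ n : ℕ, ∃ t : ℕ, 0 < t ∧ F^[n] c (k + s * t) ≠ 1 := by
  by_contra! h
  obtain ⟨ε, hε, hF⟩ := hF
  obtain ⟨M, hM⟩ := exists_pow_lt_of_lt_one hε (by norm_num : (2⁻¹ : ℝ) < 1)
  have hne : translateBy (k + s * M) c ≠ 1 := by
    intro h1
    apply hc
    simpa [translateBy] using congrFun h1 (-(s * M))
  obtain ⟨n, hn⟩ := hF _ _ hne
  rw [iterate_fixed hone] at hn
  have hle : tychDist (F^[n] (translateBy (k + s * M) c)) 1 ≤ (2 : ℝ) ^ (-(M : ℤ)) := by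
    apply tychDist_le
    intro j hj
    rw [((commute_translateBy hshift _).iterate_left n).eq c]
    have hpos : 0 < M + s * j := by
      rcases mul_self_eq_one_iff.mp hs with rfl | rfl <;> lia
    have := h n (M + s * j).toNat (by lia)
    rw [Int.toNat_of_nonneg hpos.le, mul_add, ← mul_assoc, hs, one_mul] at this
    simpa only [translateBy, Pi.one_apply, add_comm, add_left_comm, add_assoc] using this
  rw [zpow_neg, zpow_natCast, ← inv_pow] at hle
  linarith

theorem exists_bound_of_exists_iterate_ne {A : Type*} [One A] [Finite A] [TopologicalSpace A]
    [DiscreteTopology A] {F : (ℤ → A) → (ℤ → A)} (hcont : Continuous F) {s k : ℤ}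
    (h : ∀ c : ℤ → A, c k ≠ 1 → ∃ n : ℕ, ∃ t : ℕ, 0 < t ∧ F^[n] c (k + s * t) ≠ 1) :
    ∃ W : ℕ, ∀ c : ℤ → A, c k ≠ 1 →
      ∃ n : ℕ, ∃ t : ℕ, 0 < t ∧ t ≤ W ∧ F^[n] c (k + s * t) ≠ 1 := by
  by_contra! hW
  let C : ℕ → Set (ℤ → A) := fun W =>
    {c | c k ≠ 1 ∧ ∀ n t : ℕ, 0 < t → t ≤ W → F^[n] c (k + s * t) = 1}
  have hclosed : ∀ W, IsClosed (C W) := by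
    intro W
    have hC : C W = {c | c k ≠ 1} ∩ ⋂ (n : ℕ) (t : ℕ) (_ : 0 < t) (_ : t ≤ W),
        {c | F^[n] c (k + s * t) = 1} := by
      ext c
      simp [C]
    rw [hC]
    refine IsClosed.inter ?_ (isClosed_iInter fun n => isClosed_iInter fun t =>
      isClosed_iInter fun _ => isClosed_iInter fun _ => ?_)
    · exact (isClosed_discrete {a : A | a ≠ 1}).preimage
        (continuous_apply k : Continuous fun c : ℤ → A => c k)
    · exact isClosed_eq ((continuous_apply _).comp (hcont.iterate n)) continuous_const
  obtain ⟨c, hc⟩ := IsCompact.nonempty_iInter_of_sequence_nonempty_isCompact_isClosed C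
    (fun W c hc => ⟨hc.1, fun n t h0 ht => hc.2 n t h0 (ht.trans W.le_succ)⟩)
    (fun W => hW W) (hclosed 0).isCompact hclosed
  rw [Set.mem_iInter] at hc
  obtain ⟨n, t, ht, hne⟩ := h c (hc 0).1
  exact hne ((hc t).2 n t ht le_rfl)

theorem exists_iterate_ne_near_zero {A : Type*} [One A] {F : (ℤ → A) → (ℤ → A)}
    (hshift : F ∘ shiftMap A = shiftMap A ∘ F) {s k : ℤ} (hs : s * s = 1) {W : ℕ}
    (h : ∀ c : ℤ → A, c k ≠ 1 →
      ∃ n : ℕ, ∃ t : ℕ, 0 < t ∧ t ≤ W ∧ F^[n] c (k + s * t) ≠ 1)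
    (d : ℕ) (c : ℤ → A) (hc : c (-(s * d)) ≠ 1) :
    ∃ n : ℕ, ∃ j : ℤ, j.natAbs ≤ W ∧ F^[n] c j ≠ 1 := by
  induction d using Nat.strong_induction_on generalizing c with
  | _ d ih =>
    by_cases hd : d ≤ W
    · refine ⟨0, _, ?_, hc⟩
      rcases mul_self_eq_one_iff.mp hs with rfl | rfl <;> lia
    · obtain ⟨n, t, ht, htW, hne⟩ := h (translateBy (-(s * d) - k) c) (by
        simpa only [translateBy, add_sub_cancel] using hc)
      rw [((commute_translateBy hshift _).iterate_left n).eq c] at hne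
      obtain ⟨m, j, hj, hm⟩ := ih (d - t) (by lia) (F^[n] c) (by
        rw [Nat.cast_sub (by lia)]
        convert hne using 1
        exact congrArg (F^[n] c) (by ring))
      exact ⟨m + n, j, hj, by rwa [iterate_add_apply]⟩

theorem posExpansive_of_exists_iterate_ne {G : Type*} [Group G] {F : (ℤ → G) → (ℤ → G)}
    (hhom : ∀ c c' : ℤ → G, F (c * c') = F c * F c') {W : ℕ}
    (h : ∀ c : ℤ → G, c ≠ 1 → ∃ n : ℕ, ∃ j : ℤ, j.natAbs ≤ W ∧ F^[n] c j ≠ 1) :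
    PosExpansive F := by
  refine ⟨(2 : ℝ) ^ (-((W + 1 : ℕ) : ℤ)), by positivity, fun c c' hne => ?_⟩
  obtain ⟨n, j, hj, hn⟩ := h (c / c') (div_ne_one.mpr hne)
  refine ⟨n, lt_of_lt_of_le (zpow_lt_zpow_right₀ one_lt_two (by lia)) (le_tychDist (j := j) ?_)⟩
  intro heq
  apply hn
  have hdiv := iterate_map_div (MonoidHom.mk' F hhom) n c c'
  simp only [MonoidHom.mk'_apply] at hdiv
  have := congrFun hdiv j
  simpa [Pi.div_apply, heq] using this

/-- a (not necessarily injective) GCA is positively expansive iff every left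
front eventually (in positive time) develops a nonidentity value to the right of `k`, and
symmetrically for right fronts. -/
theorem posExpansive_iff_fronts {G : Type*} [Group G] [Fintype G]
    (F : (ℤ → G) → (ℤ → G))
    (hcont : Continuous[configTop G, configTop G] F)
    (hshift : F ∘ shiftMap G = shiftMap G ∘ F)
    (hhom : ∀ c c' : ℤ → G, F (c * c') = F c * F c')
    (k : ℤ) :
    PosExpansive F ↔
      ((∀ c ∈ Lset G k, ∃ n : ℕ, 0 < n ∧ ∃ j > k, F^[n] c j ≠ 1) ∧
       (∀ c ∈ Rset G k, ∃ n : ℕ, 0 < n ∧ ∃ j < k, F^[n] c j ≠ 1)) := by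
  have hone : F 1 = 1 := map_one (MonoidHom.mk' F hhom)
  constructor
  · intro hF
    constructor
    · rintro c ⟨hk, hc⟩
      obtain ⟨n, t, ht, hn⟩ :=
        exists_iterate_ne_of_posExpansive hshift hone hF (s := 1) (by norm_num) hk
      refine ⟨n, Nat.pos_of_ne_zero ?_, _, by lia, hn⟩
      rintro rfl
      exact hn (hc _ (by lia))
    · rintro c ⟨hk, hc⟩
      obtain ⟨n, t, ht, hn⟩ :=
        exists_iterate_ne_of_posExpansive hshift hone hF (s := -1) (by norm_num) hk
      refine ⟨n, Nat.pos_of_ne_zero ?_, _, by lia, hn⟩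
      rintro rfl
      exact hn (hc _ (by lia))
  · rintro ⟨hL, hR⟩
    let : TopologicalSpace G := ⊥
    have : DiscreteTopology G := ⟨rfl⟩
    have hF : Continuous F := hcont
    obtain ⟨W, hW⟩ := exists_bound_of_exists_iterate_ne (s := 1) (k := k) hF (by
      intro c hk
      by_cases hc : ∀ i > k, c i = 1
      · obtain ⟨n, -, j, hj, hn⟩ := hL c ⟨hk, hc⟩
        exact ⟨n, (j - k).toNat, by lia, by convert hn using 2; lia⟩
      · push Not at hc
        obtain ⟨j, hj, hn⟩ := hc
        exact ⟨0, (j - k).toNat, by lia, by convert hn using 2; exact congrArg c (by lia)⟩)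
    obtain ⟨V, hV⟩ := exists_bound_of_exists_iterate_ne (s := -1) (k := k) hF (by
      intro c hk
      by_cases hc : ∀ i < k, c i = 1
      · obtain ⟨n, -, j, hj, hn⟩ := hR c ⟨hk, hc⟩
        exact ⟨n, (k - j).toNat, by lia, by convert hn using 2; lia⟩
      · push Not at hc
        obtain ⟨j, hj, hn⟩ := hc
        exact ⟨0, (k - j).toNat, by lia, by convert hn using 2; exact congrArg c (by lia)⟩)
    apply posExpansive_of_exists_iterate_ne hhom (W := max W V)
    intro c hc
    obtain ⟨i, hi⟩ := Function.ne_iff.mp hc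
    rcases le_total i 0 with h0 | h0
    · obtain ⟨n, j, hj, hn⟩ := exists_iterate_ne_near_zero hshift (by norm_num) hW i.natAbs c
        (by rw [Pi.one_apply] at hi; convert hi using 2; lia)
      exact ⟨n, j, hj.trans (le_max_left _ _), hn⟩
    · obtain ⟨n, j, hj, hn⟩ := exists_iterate_ne_near_zero hshift (by norm_num) hV i.natAbs c
        (by rw [Pi.one_apply] at hi; convert hi using 2; lia)
      exact ⟨n, j, hj.trans (le_max_right _ _), hn⟩
end

section
/- Let G be a finite group and let F be an injective group cellular automaton on G that is expansive, with expansivity constant k_F. Let c ∈ L(k) be an upper angular configuration for F. Then for every integer i < 0 there exists j ∈ {1, …, k_F} such that pos(F^{i−j}(c)) > pos(F^{i}(c)). -/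
open Function Topology

section CellularAutomata

variable {A : Type*}

lemma shiftMap_iterate_apply (n : ℕ) (c : ℤ → A) (i : ℤ) :
    (shiftMap A)^[n] c i = c (i + n) := by
  induction n generalizing c with
  | zero => simp
  | succ n ih =>
    rw [iterate_succ_apply, ih]
    simp only [shiftMap]
    congr 1
    push_cast
    ring

lemma apply_translate_nat {F : (ℤ → A) → (ℤ → A)} (hF : F ∘ shiftMap A = shiftMap A ∘ F)
    (n : ℕ) (c : ℤ → A) : F (fun i => c (i + n)) = fun i => F c (i + n) := by
  have hcomm : Function.Commute F (shiftMap A) := fun c => congrFun hF c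
  have key := (hcomm.iterate_right n) c
  rw [show (shiftMap A)^[n] c = fun i => c (i + n) from
    funext (shiftMap_iterate_apply n c)] at key
  rw [key]
  exact funext (shiftMap_iterate_apply n (F c))

lemma apply_translate {F : (ℤ → A) → (ℤ → A)} (hF : F ∘ shiftMap A = shiftMap A ∘ F)
    (m : ℤ) (c : ℤ → A) : F (fun i => c (i + m)) = fun i => F c (i + m) := by
  obtain ⟨n, rfl | rfl⟩ := m.eq_nat_or_neg
  · exact apply_translate_nat hF n c
  · have h := apply_translate_nat hF n (fun i => c (i + -(n : ℤ)))
    simp only [add_neg_cancel_right] at h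
    rw [h]
    simp

/-- The configurations of period `n`. -/
def periodicConfigs (A : Type*) (n : ℕ) : Set (ℤ → A) := {c | ∀ i, c (i + n) = c i}

lemma apply_emod_of_mem_periodicConfigs {n : ℕ} {c : ℤ → A} (hc : c ∈ periodicConfigs A n)
    (i : ℤ) : c (i % n) = c i := by
  have hper : Function.Periodic c (n : ℤ) := hc
  rw [Int.emod_def, mul_comm]
  exact hper.sub_int_mul_eq (i / n)

lemma finite_periodicConfigs [Finite A] {n : ℕ} (hn : 0 < n) : (periodicConfigs A n).Finite := by
  have hinj : Set.InjOn (fun (c : ℤ → A) (i : Fin n) => c (i : ℕ)) (periodicConfigs A n) := by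
    intro c hc d hd h
    funext i
    have hn' : (0 : ℤ) < n := by exact_mod_cast hn
    have h0 := Int.emod_nonneg i hn'.ne'
    have h1 := Int.emod_lt_of_pos i hn'
    have := congrFun h ⟨(i % n).toNat, by omega⟩
    simp only [Int.toNat_of_nonneg h0] at this
    rwa [apply_emod_of_mem_periodicConfigs hc, apply_emod_of_mem_periodicConfigs hd] at this
  exact Set.Finite.of_finite_image (Set.toFinite _) hinj

/-- An injective shift-commuting map hits every periodic configuration. -/
lemma periodicConfigs_subset_range [Finite A] {F : (ℤ → A) → (ℤ → A)}
    (hF : F ∘ shiftMap A = shiftMap A ∘ F) (hinj : Function.Injective F) {n : ℕ} (hn : 0 < n) :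
    periodicConfigs A n ⊆ Set.range F := by
  have hmaps : Set.MapsTo F (periodicConfigs A n) (periodicConfigs A n) := by
    intro c hc i
    rw [← congrFun (apply_translate_nat hF n c) i, show (fun i => c (i + n)) = c from funext hc]
  have := (finite_periodicConfigs (A := A) hn).to_subtype
  have hsurj := Finite.surjective_of_injective
    (hmaps.restrict_inj.2 hinj.injOn)
  intro c hc
  obtain ⟨d, hd⟩ := hsurj ⟨c, hc⟩
  exact ⟨d, congrArg Subtype.val hd⟩

lemma exists_periodicConfigs_tendsto [TopologicalSpace A] (c : ℤ → A) :
    ∃ d : ℕ → ℤ → A, (∀ N, d N ∈ periodicConfigs A (2 * N + 1)) ∧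
      Filter.Tendsto d Filter.atTop (𝓝 c) := by
  refine ⟨fun N i => c ((i + N) % ((2 * N + 1 : ℕ) : ℤ) - N), fun N i => ?_, ?_⟩
  · simp only
    rw [show i + ((2 * N + 1 : ℕ) : ℤ) + N = i + N + ((2 * N + 1 : ℕ) : ℤ) by ring,
      Int.add_emod_right]
  · refine tendsto_pi_nhds.2 fun i => tendsto_nhds_of_eventually_eq ?_
    filter_upwards [Filter.eventually_ge_atTop i.natAbs] with N hN
    rw [Int.emod_eq_of_lt (by omega) (by omega), add_sub_cancel_right]

/-- Injective cellular automata on `ℤ` are surjective. -/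
lemma surjective_of_injective_of_commute_shift [TopologicalSpace A] [DiscreteTopology A] [Finite A]
    {F : (ℤ → A) → (ℤ → A)} (hcont : Continuous F)
    (hF : F ∘ shiftMap A = shiftMap A ∘ F) (hinj : Function.Injective F) :
    Function.Surjective F := by
  intro c
  obtain ⟨d, hd, hlim⟩ := exists_periodicConfigs_tendsto c
  exact (isCompact_range hcont).isClosed.mem_of_tendsto hlim
    (Filter.Eventually.of_forall fun N => periodicConfigs_subset_range hF hinj (by omega) (hd N))

end CellularAutomata

section GroupCellularAutomata

variable {G : Type*}

/-- A shift-commuting map that is continuous at the trivial configuration, which it fixes,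
preserves boundedness above of supports. -/
lemma exists_bound_support [One G] [TopologicalSpace G] [DiscreteTopology G]
    {F : (ℤ → G) → (ℤ → G)} (hcont : Continuous F) (hF : F ∘ shiftMap G = shiftMap G ∘ F)
    (hone : F 1 = 1) {c : ℤ → G} (hc : ∃ m : ℤ, ∀ j > m, c j = 1) :
    ∃ m : ℤ, ∀ j > m, F c j = 1 := by
  obtain ⟨m, hm⟩ := hc
  have hnhds : {c : ℤ → G | F c 0 = 1} ∈ 𝓝 (1 : ℤ → G) :=
    ((isOpen_discrete {(1 : G)}).preimage ((continuous_apply (0 : ℤ)).comp hcont)).mem_nhds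
      (by simp [hone])
  rw [nhds_pi, Filter.mem_pi] at hnhds
  obtain ⟨I, hI, t, ht, hsub⟩ := hnhds
  obtain ⟨b, hb⟩ := hI.bddBelow
  refine ⟨m - b, fun j hj => ?_⟩
  have hmem : (fun i => c (i + j)) ∈ I.pi t := by
    intro i hi
    have := hb hi
    change c (i + j) ∈ t i
    rw [hm (i + j) (by omega)]
    exact mem_of_mem_nhds (ht i)
  have h : F (fun i => c (i + j)) 0 = 1 := hsub hmem
  simpa only [apply_translate hF j c, zero_add] using h

lemma mem_Lset_pos [One G] {c : ℤ → G} (hc : c ≠ 1) (hb : ∃ m : ℤ, ∀ j > m, c j = 1) :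
    c ∈ Lset G (pos c) := by
  obtain ⟨m, hm⟩ := hb
  have hbdd : BddAbove {j : ℤ | c j ≠ 1} :=
    ⟨m, fun j hj => not_lt.1 fun h => hj (hm j h)⟩
  have hne : {j : ℤ | c j ≠ 1}.Nonempty := Function.ne_iff.1 hc
  exact ⟨Int.csSup_mem hne hbdd, fun i hi => by_contra fun h => hi.not_ge (le_csSup hbdd h)⟩

lemma pos_le [One G] {c : ℤ → G} (hc : c ≠ 1) {m : ℤ} (hm : ∀ j > m, c j = 1) : pos c ≤ m :=
  csSup_le (Function.ne_iff.1 hc) fun j hj => not_lt.1 fun h => hj (hm j h)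

lemma pos_eq_of_mem_Lset [One G] {c : ℤ → G} {k : ℤ} (hc : c ∈ Lset G k) : pos c = k := by
  have hne : c ≠ 1 := fun h => hc.1 (congrFun h k)
  refine le_antisymm (pos_le hne hc.2) (not_lt.1 fun h => hc.1 ?_)
  exact (mem_Lset_pos hne ⟨k, hc.2⟩).2 k h

end GroupCellularAutomata

lemma zIter_eq_zpow {A : Type*} [Nonempty A] {F : (ℤ → A) → (ℤ → A)} (e : Equiv.Perm (ℤ → A))
    (he : ⇑e = F) (n : ℤ) : zIter F n = ⇑(e ^ n) := by
  subst he
  have hinv : Function.invFun e = ⇑e⁻¹ := by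
    funext c
    refine e.injective ?_
    rw [Function.invFun_eq (e.surjective c)]
    simp
  unfold zIter
  split_ifs with h
  · lift n to ℕ using h
    simp [Equiv.Perm.iterate_eq_pow]
  · obtain ⟨m, rfl⟩ : ∃ m : ℕ, n = -m := ⟨(-n).toNat, by omega⟩
    rw [hinv, Equiv.Perm.iterate_eq_pow]
    simp

/-- If every time `t ∈ [a, b]` is exceeded by `p` at some time within distance `r`, then either
`p a` is exceeded within `r` steps before `a`, or `p b` within `r` steps after `b`. -/
lemma exists_exceeds_before_or_after {p : ℤ → ℤ} {r : ℕ} {a b : ℤ} (hab : a ≤ b)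
    (h : ∀ t, ∃ n : ℤ, n.natAbs ≤ r ∧ p t < p (t + n)) :
    (∃ j : ℕ, 1 ≤ j ∧ j ≤ r ∧ p a < p (a - j)) ∨ ∃ j : ℕ, j ≤ r ∧ p b < p (b + j) := by
  by_contra! hcon
  obtain ⟨hbefore, hafter⟩ := hcon
  obtain ⟨t, ht, hmax⟩ := (Finset.Icc a b).exists_max_image p ⟨a, Finset.mem_Icc.2 ⟨le_rfl, hab⟩⟩
  rw [Finset.mem_Icc] at ht
  obtain ⟨n, hn, hlt⟩ := h t
  refine hlt.not_ge ?_
  rcases lt_or_ge (t + n) a with h1 | h1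
  · have := hbefore (a - (t + n)).toNat (by omega) (by omega)
    rw [show a - ((a - (t + n)).toNat : ℤ) = t + n by omega] at this
    exact this.trans (hmax a (Finset.mem_Icc.2 ⟨le_rfl, hab⟩))
  rcases lt_or_ge b (t + n) with h2 | h2
  · have := hafter (t + n - b).toNat (by omega)
    rw [show b + ((t + n - b).toNat : ℤ) = t + n by omega] at this
    exact this.trans (hmax b (Finset.mem_Icc.2 ⟨hab, le_rfl⟩))
  · exact hmax _ (Finset.mem_Icc.2 ⟨h1, h2⟩)

/-- for an expansive injective GCA with expansivity constant `kF`, the position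
of an upper angular left front increases, within `kF` backward iterations, at every negative
time. -/
theorem upperAngular_pos_increases {G : Type*} [Group G] [Fintype G]
    (F : (ℤ → G) → (ℤ → G))
    (hcont : Continuous[configTop G, configTop G] F)
    (hshift : F ∘ shiftMap G = shiftMap G ∘ F)
    (hhom : ∀ c c' : ℤ → G, F (c * c') = F c * F c')
    (hinj : Function.Injective F)
    (hexp : Expansive F) (kF : ℕ) (hkF : ExpConstant F kF)
    (k : ℤ) (c : ℤ → G) (hc : c ∈ Lset G k)
    (hupper : ∀ i : ℕ, i ≤ kF → ∀ j > k, zIter F (i : ℤ) c j = 1) :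
    ∀ i : ℤ, i < 0 → ∃ j : ℕ, 1 ≤ j ∧ j ≤ kF ∧
      pos (zIter F (i - (j : ℤ)) c) > pos (zIter F i c) := by
  let _ : TopologicalSpace G := ⊥
  have : DiscreteTopology G := ⟨rfl⟩
  replace hcont : Continuous F := hcont
  have hone : F 1 = 1 := by simpa using hhom 1 1
  have hbij : Function.Bijective F :=
    ⟨hinj, surjective_of_injective_of_commute_shift hcont hshift hinj⟩
  let e : Equiv.Perm (ℤ → G) := Equiv.ofBijective F hbij
  have hz : ∀ n, zIter F n = ⇑(e ^ n) := zIter_eq_zpow e rfl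
  have hsymm_cont : Continuous e.symm :=
    Continuous.continuous_symm_of_equiv_compact_to_t2 (f := e) hcont
  have hsymm_one : e.symm 1 = 1 := e.symm_apply_eq.2 hone.symm
  have hsymm_shift : e.symm ∘ shiftMap G = shiftMap G ∘ e.symm := by
    funext d
    refine e.symm_apply_eq.2 ?_
    have := congrFun hshift (e.symm d)
    simp only [comp_apply] at this ⊢
    exact (this.trans (congrArg _ (e.apply_symm_apply d))).symm
  have hc_ne : c ≠ 1 := fun h => hc.1 (congrFun h k)
  have hzone : ∀ n : ℤ, (e ^ n) 1 = 1 := fun n =>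
    (Equiv.Perm.zpow_apply_eq_self_of_apply_eq_self (f := e) hone n)
  have hne : ∀ n : ℤ, (e ^ n) c ≠ 1 := fun n h =>
    hc_ne ((e ^ n).injective (h.trans (hzone n).symm))
  have hbdd : ∀ n : ℤ, ∃ m : ℤ, ∀ j > m, (e ^ n) c j = 1 := by
    intro n
    induction n with
    | zero => exact ⟨k, hc.2⟩
    | succ n ih =>
      rw [add_comm, zpow_add, zpow_one]
      exact exists_bound_support hcont hshift hone ih
    | pred n ih =>
      rw [sub_eq_add_neg, add_comm, zpow_add, zpow_neg_one]
      exact exists_bound_support hsymm_cont hsymm_shift hsymm_one ih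
  simp only [hz] at hupper ⊢
  intro i hi
  have hexceed : ∀ t : ℤ, ∃ n : ℤ, n.natAbs ≤ kF ∧
      pos ((e ^ t) c) < pos ((e ^ (t + n)) c) := by
    intro t
    obtain ⟨n, hn, hlt⟩ := (hkF.2 _).1 _ (mem_Lset_pos (hne t) (hbdd t))
    rw [hz, ← Equiv.Perm.mul_apply, ← zpow_add, add_comm] at hlt
    exact ⟨n, hn, hlt⟩
  rcases exists_exceeds_before_or_after (p := fun t => pos ((e ^ t) c)) hi.le hexceed
    with h | ⟨j, hj, hlt⟩
  · exact h
  · refine absurd (pos_le (hne j) (hupper j hj)) (not_le.2 ?_)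
    simpa [pos_eq_of_mem_Lset hc] using hlt
end

section
/- Let G = S₁ × ⋯ × S_m be a direct product of finitely many pairwise isomorphic finite non-abelian simple groups, and let F be an injective group cellular automaton on G. Then F is topologically transitive if and only if F is expansive. -/
open Function Topology

section GroupLemmas

variable {A B : Type*} [Group A] [Group B]

theorem IsSimpleGroup.center_eq_bot_of_not_commute [IsSimpleGroup A]
    (h : ∃ a b : A, a * b ≠ b * a) : Subgroup.center A = ⊥ := by
  rcases (inferInstance : (Subgroup.center A).Normal).eq_bot_or_eq_top with h' | h'
  · exact h'
  · obtain ⟨a, b, hab⟩ := h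
    have : b ∈ Subgroup.center A := h' ▸ Subgroup.mem_top b
    exact absurd (Subgroup.mem_center_iff.1 this a) hab

theorem MonoidHom.bijective_of_isSimpleGroup [IsSimpleGroup A] [Finite A] (e : A ≃* B)
    (f : A →* B) {g : A} (hg : f g ≠ 1) : Function.Bijective f := by
  have hker : f.ker = ⊥ := by
    rcases f.normal_ker.eq_bot_or_eq_top with h | h
    · exact h
    · exact absurd (f.mem_ker.1 (h ▸ Subgroup.mem_top g)) hg
  have hi : Function.Injective f := (f.ker_eq_bot_iff).1 hker
  have : Finite B := Finite.of_equiv A e.toEquiv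
  exact (Nat.bijective_iff_injective_and_card f).2 ⟨hi, Nat.card_congr e.toEquiv⟩

variable {ι : Type*} [DecidableEq ι] {M : ι → Type*} [∀ x, Group (M x)]

theorem Pi.mulSingle_mul_update_one (c : ∀ x, M x) (y : ι) :
    Pi.mulSingle y (c y) * Function.update c y 1 = c := by
  funext x
  by_cases h : x = y
  · subst h; simp
  · simp [h]

/-- A homomorphism on a product which only depends on finitely many coordinates and kills every
factor but the `y`-th one is trivial on elements whose `y`-th coordinate is trivial. -/
theorem MonoidHom.map_eq_one_of_apply_eq_one (f : (∀ x, M x) →* B) (s : Finset ι)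
    (hs : ∀ c, (∀ x ∈ s, c x = 1) → f c = 1) (y : ι)
    (hy : ∀ x, x ≠ y → ∀ g, f (Pi.mulSingle x g) = 1) (c : ∀ x, M x) (hc : c y = 1) :
    f c = 1 := by
  have key : ∀ t : Finset ι, ∀ c : ∀ x, M x, c y = 1 → (∀ x ∈ s, x ∉ t → c x = 1) → f c = 1 := by
    intro t
    induction t using Finset.induction_on with
    | empty => exact fun c _ h => hs c fun x hx => h x hx (Finset.notMem_empty x)
    | insert z t _ ih =>
      intro c hc h
      rw [← Pi.mulSingle_mul_update_one c z, map_mul]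
      have h1 : f (Pi.mulSingle z (c z)) = 1 := by
        by_cases hz : z = y
        · subst hz; simp [hc]
        · exact hy z hz _
      rw [h1, one_mul]
      refine ih _ ?_ fun x hx hxt => ?_
      · by_cases hz : y = z
        · subst hz; simp
        · simp [hz, hc]
      · by_cases hz : x = z
        · subst hz; simp
        · simp only [Function.update_of_ne hz]
          exact h x hx (by simp [hz, hxt])
  exact key s c hc fun x hx hx' => absurd hx hx'

/-- If a homomorphism to a group with trivial center is onto from one factor, it kills the
other factors. -/
theorem MonoidHom.map_mulSingle_eq_one_of_surjective (f : (∀ x, M x) →* B)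
    (hB : Subgroup.center B = ⊥) {y : ι}
    (hy : Function.Surjective fun g => f (Pi.mulSingle y g)) {x : ι} (hx : x ≠ y) (g : M x) :
    f (Pi.mulSingle x g) = 1 := by
  rw [← Subgroup.mem_bot, ← hB, Subgroup.mem_center_iff]
  intro b
  obtain ⟨h, rfl⟩ := hy b
  simp only [← map_mul]
  rw [(Pi.mulSingle_commute hx.symm h g).eq]

end GroupLemmas

section Configurations

theorem exists_window_of_isOpen {A : Type*} {U : Set (ℤ → A)} (hU : IsOpen[configTop A] U)
    {c : ℤ → A} (hc : c ∈ U) :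
    ∃ N : ℕ, ∀ c' : ℤ → A, (∀ j : ℤ, |j| ≤ N → c' j = c j) → c' ∈ U := by
  let _ : TopologicalSpace A := ⊥
  have hU' : IsOpen U := hU
  obtain ⟨I, u, hu, hI⟩ := isOpen_pi_iff.1 hU' c hc
  refine ⟨∑ j ∈ I, j.natAbs, fun c' h => hI fun j hj => ?_⟩
  have hj' : j.natAbs ≤ ∑ j ∈ I, j.natAbs :=
    Finset.single_le_sum (f := fun j : ℤ => j.natAbs) (fun _ _ => Nat.zero_le _) hj
  rw [h j (by rw [Int.abs_eq_natAbs]; exact_mod_cast hj')]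
  exact (hu j hj).2

theorem isOpen_setOf_apply {A : Type*} (i : ℤ) (p : A → Prop) :
    IsOpen[configTop A] {c | p (c i)} := by
  let _ : TopologicalSpace A := ⊥
  have : DiscreteTopology A := ⟨rfl⟩
  exact (isOpen_discrete {a | p a}).preimage (continuous_apply i)

theorem tychDist_le_of_eqOn {A : Type*} {c c' : ℤ → A} {K : ℕ}
    (h : ∀ j : ℤ, |j| ≤ K → c j = c' j) : tychDist c c' ≤ (2 : ℝ) ^ (-(K : ℤ)) := by
  unfold tychDist
  split_ifs with hc
  · positivity
  · refine zpow_le_zpow_right₀ (by norm_num) (neg_le_neg ?_)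
    obtain ⟨j, hj⟩ := Function.ne_iff.1 hc
    norm_cast
    refine le_csInf (Set.nonempty_of_mem (x := j.natAbs) ⟨j, rfl, hj⟩) ?_
    rintro n ⟨i, rfl, hi⟩
    by_contra hlt
    exact hi (h i (by rw [Int.abs_eq_natAbs]; exact_mod_cast (not_le.1 hlt).le))

theorem le_tychDist_of_ne {A : Type*} {c c' : ℤ → A} {K : ℕ} {j : ℤ} (hj : |j| ≤ K)
    (h : c j ≠ c' j) : (2 : ℝ) ^ (-(K : ℤ)) ≤ tychDist c c' := by
  unfold tychDist
  rw [if_neg fun hc => h (congrFun hc j)]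
  refine zpow_le_zpow_right₀ (by norm_num) (neg_le_neg ?_)
  norm_cast
  rw [Int.abs_eq_natAbs] at hj
  have hmem : j.natAbs ∈ {n : ℕ | ∃ j : ℤ, j.natAbs = n ∧ c j ≠ c' j} := ⟨j, rfl, h⟩
  exact (Nat.sInf_le hmem).trans (by exact_mod_cast hj)

theorem map_translate {A : Type*} {F : (ℤ → A) → (ℤ → A)}
    (hshift : F ∘ shiftMap A = shiftMap A ∘ F) (c : ℤ → A) (t : ℤ) :
    F (fun i => c (i + t)) = fun i => F c (i + t) := by
  have h1 : ∀ c, F (fun i => c (i + 1)) = fun i => F c (i + 1) := fun c => congrFun hshift c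
  induction t generalizing c with
  | zero => simp
  | succ n ih =>
    have := h1 fun i => c (i + n)
    rw [ih] at this
    simpa [add_assoc, add_comm, add_left_comm] using this
  | pred n ih =>
    have h2 := h1 fun i => c (i + (-n - 1))
    have h3 : (fun i : ℤ => c (i + 1 + (-n - 1))) = fun i => c (i + -n) := by
      funext i; congr 1; ring
    rw [h3, ih] at h2
    funext i
    have h4 := congrFun h2 (i - 1)
    simp only [sub_add_cancel] at h4
    rw [← h4]
    congr 1
    ring

end Configurations

section Transport

variable {κ : Type*} {S : κ → Type*}

/-- `F` transports the content of the cell `y` injectively to the cell `E y`, which is influenced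
by no other cell. -/
def Transports (F : (ℤ → ∀ b, S b) → (ℤ → ∀ b, S b)) (E : Equiv.Perm (ℤ × κ)) : Prop :=
  ∀ c c' y, F c (E y).1 (E y).2 = F c' (E y).1 (E y).2 ↔ c y.1 y.2 = c' y.1 y.2

theorem Transports.iterate {F : (ℤ → ∀ b, S b) → (ℤ → ∀ b, S b)} {E : Equiv.Perm (ℤ × κ)}
    (h : Transports F E) (n : ℕ) : Transports F^[n] (E ^ n) := by
  induction n with
  | zero => exact fun _ _ _ => Iff.rfl
  | succ n ih =>
    intro c c' y
    rw [Function.iterate_succ_apply', Function.iterate_succ_apply', pow_succ',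
      Equiv.Perm.mul_apply, h]
    exact ih c c' y

theorem Transports.invFun [Nonempty (∀ b, S b)] {F : (ℤ → ∀ b, S b) → (ℤ → ∀ b, S b)}
    {E : Equiv.Perm (ℤ × κ)} (h : Transports F E) (hF : Function.Surjective F) :
    Transports (Function.invFun F) E⁻¹ := by
  intro c c' y
  rw [← h, Function.rightInverse_invFun hF, Function.rightInverse_invFun hF,
    Equiv.Perm.coe_inv, Equiv.apply_symm_apply]

theorem Transports.zIter [Nonempty (∀ b, S b)] {F : (ℤ → ∀ b, S b) → (ℤ → ∀ b, S b)}
    {E : Equiv.Perm (ℤ × κ)} (h : Transports F E) (hF : Function.Surjective F) (n : ℤ) :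
    Transports (zIter F n) (E ^ n) := by
  unfold _root_.zIter
  split_ifs with hn
  · have := h.iterate n.toNat
    rwa [← zpow_natCast, Int.toNat_of_nonneg hn] at this
  · have := (h.invFun hF).iterate (-n).toNat
    rwa [← zpow_natCast, Int.toNat_of_nonneg (by omega), inv_zpow', neg_neg] at this

theorem exists_pow_eq_translation {k : κ → ℤ} {β : Equiv.Perm κ}
    {E : Equiv.Perm (ℤ × κ)} (hE : ∀ i b, E (i, b) = (i + k b, β b)) :
    ∃ D : ℕ → κ → ℤ, ∀ n i b, (E ^ n) (i, b) = (i + D n b, (β ^ n) b) := by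
  suffices h : ∀ n : ℕ, ∃ D : κ → ℤ, ∀ i b, (E ^ n) (i, b) = (i + D b, (β ^ n) b) by
    choose D hD using h
    exact ⟨D, hD⟩
  intro n
  induction n with
  | zero => exact ⟨0, by simp⟩
  | succ n ih =>
    obtain ⟨D, hD⟩ := ih
    refine ⟨fun b => D b + k ((β ^ n) b), fun i b => ?_⟩
    rw [pow_succ', Equiv.Perm.mul_apply, hD, hE, pow_succ', Equiv.Perm.mul_apply, add_assoc]

theorem zpow_mul_eq_translation {E : Equiv.Perm (ℤ × κ)} {L : ℕ} {D : κ → ℤ}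
    (hD : ∀ i b, (E ^ L) (i, b) = (i + D b, b)) (t : ℤ) (i : ℤ) (b : κ) :
    (E ^ (L * t : ℤ)) (i, b) = (i + t * D b, b) := by
  rw [zpow_mul, zpow_natCast]
  induction t generalizing i with
  | zero => simp
  | succ n ih =>
    rw [zpow_add_one, Equiv.Perm.mul_apply, hD, ih]
    congr 1; ring
  | pred n ih =>
    have h : (E ^ L)⁻¹ (i, b) = (i - D b, b) := by
      rw [Equiv.Perm.inv_eq_iff_eq, hD, sub_add_cancel]
    rw [zpow_sub_one, Equiv.Perm.mul_apply, h, ih]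
    congr 1; ring

theorem exists_pow_apply_eq_zpow_apply {α : Type*} {E : Equiv.Perm α} {L : ℕ} (hL : 0 < L) {x : α}
    (hx : (E ^ L) x = x) (n : ℤ) : ∃ r < L, (E ^ n) x = (E ^ r) x := by
  refine ⟨(n % L).toNat, ?_, ?_⟩
  · have := Int.emod_lt_of_pos n (by omega : (0 : ℤ) < L)
    omega
  · have h0 : ((n % L).toNat : ℤ) = n % L :=
      Int.toNat_of_nonneg (Int.emod_nonneg _ (by omega))
    rw [← zpow_natCast, h0]
    conv_lhs => rw [← Int.emod_add_mul_ediv n L, zpow_add, Equiv.Perm.mul_apply, zpow_mul,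
      zpow_natCast]
    rw [Equiv.Perm.zpow_apply_eq_self_of_apply_eq_self hx]

end Transport

section Dynamics

variable {κ : Type*} {S : κ → Type*} {F : (ℤ → ∀ b, S b) → (ℤ → ∀ b, S b)}
  {E : Equiv.Perm (ℤ × κ)} {L : ℕ} {D : κ → ℤ}

theorem Transports.topTransitive [Finite κ] (h : Transports F E) (hF : Function.Surjective F)
    (hD : ∀ i b, (E ^ L) (i, b) = (i + D b, b)) (hne : ∀ b, D b ≠ 0) :
    TopTransitive F := by
  classical
  rintro U V hU hV ⟨u, hu⟩ ⟨v, hv⟩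
  obtain ⟨N, hN⟩ := exists_window_of_isOpen hU hu
  obtain ⟨M, hM⟩ := exists_window_of_isOpen hV hv
  set t : ℕ := N + M + 1
  have hFn : Function.Surjective F^[L * t] := hF.iterate _
  obtain ⟨w, hw⟩ := hFn v
  let c : ℤ → ∀ b, S b := fun i => if |i| ≤ N then u i else w i
  refine ⟨L * t, F^[L * t] c, ⟨c, hN c fun j hj => if_pos hj, rfl⟩, hM _ fun j hj => ?_⟩
  funext b
  rw [← hw]
  have hE : (E ^ (L * t)) (j - t * D b, b) = (j, b) := by
    have := zpow_mul_eq_translation hD t (j - t * D b) b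
    rw [sub_add_cancel] at this
    exact_mod_cast this
  have key := h.iterate (L * t) c w (j - t * D b, b)
  rw [hE] at key
  refine key.2 ?_
  have hbig : ¬ |j - t * D b| ≤ N := by
    have h1 : (1 : ℤ) ≤ |D b| := Int.one_le_abs (hne b)
    have h2 : |(t : ℤ) * D b| = t * |D b| := by rw [abs_mul, Nat.abs_cast]
    have h3 : |(t : ℤ) * D b| ≤ |j| + |j - t * D b| := by
      have := abs_sub j (j - t * D b)
      rwa [sub_sub_cancel] at this
    have h4 : (t : ℤ) = N + M + 1 := by simp [t]
    nlinarith
  simp only [c, if_neg hbig]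

theorem Transports.expansive [Finite κ] [Nonempty (∀ b, S b)] (h : Transports F E)
    (hF : Function.Surjective F) (hD : ∀ i b, (E ^ L) (i, b) = (i + D b, b))
    (hne : ∀ b, D b ≠ 0) : Expansive F := by
  have := Fintype.ofFinite κ
  set K : ℕ := ∑ b, (D b).natAbs
  refine ⟨(2 : ℝ) ^ (-(K : ℤ)) / 2, by positivity, fun c c' hc => ?_⟩
  obtain ⟨i, hi⟩ := Function.ne_iff.1 hc
  obtain ⟨b, hb⟩ := Function.ne_iff.1 hi
  have hE := zpow_mul_eq_translation hD (-(i / D b)) i b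
  have hmod : i + -(i / D b) * D b = i % D b := by
    have := Int.emod_add_mul_ediv i (D b)
    linarith
  rw [hmod] at hE
  have key := h.zIter hF (L * -(i / D b)) c c' (i, b)
  rw [hE] at key
  have hK : |i % D b| ≤ K := by
    rw [abs_of_nonneg (Int.emod_nonneg _ (hne b))]
    have h1 := Int.emod_lt_abs i (hne b)
    have h2 : (D b).natAbs ≤ K :=
      Finset.single_le_sum (f := fun b => (D b).natAbs) (fun _ _ => Nat.zero_le _)
        (Finset.mem_univ b)
    rw [Int.abs_eq_natAbs] at h1
    exact h1.le.trans (by exact_mod_cast h2)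
  refine ⟨_, lt_of_lt_of_le (half_lt_self (by positivity))
    (le_tychDist_of_ne hK fun heq => hb (key.1 (congrFun heq b)))⟩

theorem Transports.not_topTransitive [∀ b, Group (S b)] (h : Transports F E) (hF1 : F 1 = 1)
    (hL : 0 < L) {b : κ} [Nontrivial (S b)] (hb : (E ^ L) (0, b) = (0, b)) :
    ¬ TopTransitive F := by
  classical
  intro hT
  obtain ⟨g, hg⟩ := exists_ne (1 : S b)
  let U : Set (ℤ → ∀ b, S b) :=
    ⋂ r ∈ Finset.range L, {c | c ((E ^ r) (0, b)).1 ((E ^ r) (0, b)).2 = 1}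
  have hU : IsOpen[configTop (∀ b, S b)] U :=
    @isOpen_biInter_finset _ _ (configTop (∀ b, S b)) _ _ fun r _ =>
      isOpen_setOf_apply (A := ∀ b, S b) _ fun a => a ((E ^ r) (0, b)).2 = 1
  have hV : IsOpen[configTop (∀ b, S b)] {c | c 0 b ≠ 1} :=
    isOpen_setOf_apply (A := ∀ b, S b) 0 fun a => a b ≠ 1
  obtain ⟨n, _, ⟨c, hc, rfl⟩, hcV⟩ := hT U _ hU hV ⟨1, by simp [U]⟩
    ⟨fun _ => Pi.mulSingle b g, by simpa using hg⟩
  refine hcV ?_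
  have key := h.iterate n c 1 ((E ^ (-n : ℤ)) (0, b))
  rw [← zpow_natCast, ← Equiv.Perm.mul_apply, ← zpow_add, add_neg_cancel, zpow_zero,
    Function.iterate_fixed hF1] at key
  refine key.2 ?_
  obtain ⟨r, hr, hr'⟩ := exists_pow_apply_eq_zpow_apply hL hb (-n)
  rw [hr']
  exact Set.mem_iInter₂.1 hc r (Finset.mem_range.2 hr)

theorem Transports.not_expansive [∀ b, Group (S b)] (h : Transports F E)
    (hF : Function.Surjective F) (hL : 0 < L) {k : ℕ → κ → ℤ}
    {β : Equiv.Perm κ} (hk : ∀ n i b, (E ^ n) (i, b) = (i + k n b, (β ^ n) b))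
    {b : κ} [Nontrivial (S b)] (hb : ∀ i, (E ^ L) (i, b) = (i, b)) :
    ¬ Expansive F := by
  classical
  rintro ⟨ε, hε, hexp⟩
  obtain ⟨g, hg⟩ := exists_ne (1 : S b)
  obtain ⟨K, hK⟩ := exists_pow_lt_of_lt_one hε (by norm_num : (1 / 2 : ℝ) < 1)
  set R : ℕ := ∑ r ∈ Finset.range L, (k r b).natAbs
  let i : ℤ := K + R + 1
  let c : ℤ → ∀ b, S b := fun j => if j = i then Pi.mulSingle b g else 1
  have hci : c i b = g := by simp [c]
  have hoff : ∀ x : ℤ × κ, x ≠ (i, b) → c x.1 x.2 = 1 := by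
    rintro ⟨j, a⟩ hx
    by_cases hj : j = i
    · have ha : a ≠ b := fun ha => hx (by rw [hj, ha])
      simp [c, hj, ha]
    · simp [c, hj]
  have hc : c ≠ 1 := fun h1 => hg (by rw [← hci, h1]; rfl)
  obtain ⟨n, hn⟩ := hexp c 1 hc
  refine absurd hn (not_lt.2 (le_trans (tychDist_le_of_eqOn (K := K) fun j hj => ?_) ?_))
  · funext a
    have key := h.zIter hF n c 1 ((E ^ n)⁻¹ (j, a))
    rw [Equiv.Perm.coe_inv, Equiv.apply_symm_apply] at key
    refine key.2 (hoff _ fun heq => ?_)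
    rw [Equiv.symm_apply_eq] at heq
    obtain ⟨r, hr, hr'⟩ := exists_pow_apply_eq_zpow_apply hL (hb i) n
    rw [hr', hk] at heq
    have h1 : j = i + k r b := congrArg Prod.fst heq
    have h2 : (k r b).natAbs ≤ R :=
      Finset.single_le_sum (f := fun r => (k r b).natAbs) (fun _ _ => Nat.zero_le _)
        (Finset.mem_range.2 hr)
    have h3 := (abs_le.1 hj).2
    simp only [i] at h1
    omega
  · rw [zpow_neg, zpow_natCast, ← inv_pow]
    simpa using hK.le

end Dynamics

section Structure

variable {κ : Type*} [DecidableEq κ] {S : κ → Type*} [∀ b, Group (S b)]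

/-- The homomorphism reading the cell `z` of the image under an endomorphism `F`, with
configurations seen as functions on the cells. -/
def cellHom (F : (ℤ → ∀ b, S b) → (ℤ → ∀ b, S b)) (hhom : ∀ c c', F (c * c') = F c * F c')
    (z : ℤ × κ) : (∀ x : ℤ × κ, S x.2) →* S z.2 :=
  MonoidHom.mk' (fun d => F (fun i b => d (i, b)) z.1 z.2) fun d d' =>
    congrFun (congrFun (hhom (fun i b => d (i, b)) (fun i b => d' (i, b))) z.1) z.2

/-- The cell `x` influences the cell `z`. -/
def Influences (F : (ℤ → ∀ b, S b) → (ℤ → ∀ b, S b)) (x z : ℤ × κ) : Prop :=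
  ∃ g : S x.2, F (fun i b => (Pi.mulSingle x g : ∀ x : ℤ × κ, S x.2) (i, b)) z.1 z.2 ≠ 1

variable {F : (ℤ → ∀ b, S b) → (ℤ → ∀ b, S b)}

theorem Influences.translate
    (hshift : F ∘ shiftMap (∀ b, S b) = shiftMap (∀ b, S b) ∘ F)
    {i j : ℤ} {a b : κ} (h : Influences F (i, a) (j, b)) (t : ℤ) :
    Influences F (i + t, a) (j + t, b) := by
  obtain ⟨g, hg⟩ := h
  refine ⟨g, ?_⟩
  have := map_translate hshift
    (fun i' b' => (Pi.mulSingle (i + t, a) g : ∀ x : ℤ × κ, S x.2) (i', b')) t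
  have h2 := congrFun (congrFun this j) b
  convert hg using 1
  refine h2.symm.trans ?_
  congr 1
  funext i' b'
  by_cases hb : b' = a
  · subst hb
    by_cases hi : i' = i
    · subst hi; simp
    · simp [hi]
  · simp [hb]

variable [∀ b, IsSimpleGroup (S b)]

theorem exists_influences (hhom : ∀ c c', F (c * c') = F c * F c') (hinj : Function.Injective F)
    (x : ℤ × κ) : ∃ z, Influences F x z := by
  by_contra! hcon
  obtain ⟨g, hg⟩ := exists_ne (1 : S x.2)
  have hF1 : F 1 = 1 := by simpa using hhom 1 1
  have h0 : (fun i b => (Pi.mulSingle x g : ∀ x : ℤ × κ, S x.2) (i, b)) = 1 := by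
    refine hinj ?_
    rw [hF1]
    funext i b
    by_contra h
    exact hcon (i, b) ⟨g, h⟩
  have := congrFun (congrFun h0 x.1) x.2
  simp at this
  exact hg this

variable [∀ b, Finite (S b)]

theorem bijective_of_influences (hiso : ∀ a b, Nonempty (S a ≃* S b))
    (hhom : ∀ c c', F (c * c') = F c * F c') {x z : ℤ × κ}
    (h : Influences F x z) :
    Function.Bijective fun g : S x.2 => cellHom F hhom z (Pi.mulSingle x g) := by
  obtain ⟨g, hg⟩ := h
  obtain ⟨e⟩ := hiso x.2 z.2
  refine MonoidHom.bijective_of_isSimpleGroup e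
    ((cellHom F hhom z).comp (MonoidHom.mulSingle (fun x : ℤ × κ => S x.2) x)) (g := g) ?_
  exact hg

theorem Influences.map_mulSingle_eq_one (hnonab : ∀ b, ∃ g h : S b, g * h ≠ h * g)
    (hiso : ∀ a b, Nonempty (S a ≃* S b)) (hhom : ∀ c c', F (c * c') = F c * F c')
    {x y z : ℤ × κ} (h : Influences F y z) (hx : x ≠ y) (g : S x.2) :
    cellHom F hhom z (Pi.mulSingle x g) = 1 :=
  (cellHom F hhom z).map_mulSingle_eq_one_of_surjective
    (IsSimpleGroup.center_eq_bot_of_not_commute (hnonab z.2))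
    (bijective_of_influences hiso hhom h).2 hx g

theorem Influences.unique (hnonab : ∀ b, ∃ g h : S b, g * h ≠ h * g)
    (hiso : ∀ a b, Nonempty (S a ≃* S b)) (hhom : ∀ c c', F (c * c') = F c * F c')
    {x y z : ℤ × κ} (hx : Influences F x z) (hy : Influences F y z) : x = y := by
  by_contra hne
  obtain ⟨g, hg⟩ := hx
  refine hg ?_
  exact hy.map_mulSingle_eq_one hnonab hiso hhom hne g

theorem surjective_of_influences (hiso : ∀ a b, Nonempty (S a ≃* S b))
    (hhom : ∀ c c', F (c * c') = F c * F c') {E : Equiv.Perm (ℤ × κ)}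
    (hE : ∀ y, Influences F y (E y)) (h : Transports F E) : Function.Surjective F := by
  intro v
  choose d hd using fun y =>
    (bijective_of_influences hiso hhom (hE y)).2 (v (E y).1 (E y).2)
  refine ⟨fun i b => d (i, b), ?_⟩
  funext i b
  obtain ⟨y, hy⟩ := E.surjective (i, b)
  have key := (h (fun i b => d (i, b))
    (fun i b => (Pi.mulSingle y (d y) : ∀ x : ℤ × κ, S x.2) (i, b)) y).2 (by simp)
  have h2 := key.trans (hd y)
  rwa [hy] at h2

variable [Finite κ]

theorem Influences.map_eq_one (hnonab : ∀ b, ∃ g h : S b, g * h ≠ h * g)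
    (hiso : ∀ a b, Nonempty (S a ≃* S b)) (hhom : ∀ c c', F (c * c') = F c * F c')
    (hcont : Continuous[configTop (∀ b, S b), configTop (∀ b, S b)] F)
    {y z : ℤ × κ} (h : Influences F y z) (d : ∀ x : ℤ × κ, S x.2) (hd : d y = 1) :
    cellHom F hhom z d = 1 := by
  have := Fintype.ofFinite κ
  have hF1 : F 1 = 1 := by simpa using hhom 1 1
  have hopen : IsOpen[configTop (∀ b, S b)] (F ⁻¹' {c | c z.1 z.2 = 1}) :=
    @IsOpen.preimage _ _ (configTop (∀ b, S b)) (configTop (∀ b, S b)) F hcont _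
      (isOpen_setOf_apply (A := ∀ b, S b) z.1 fun a => a z.2 = 1)
  obtain ⟨N, hN⟩ := exists_window_of_isOpen hopen (c := 1) (by simp [hF1])
  refine (cellHom F hhom z).map_eq_one_of_apply_eq_one (Finset.Icc (-N : ℤ) N ×ˢ Finset.univ)
    (fun d hd => hN _ fun j hj => ?_) y
    (fun x hx g => h.map_mulSingle_eq_one hnonab hiso hhom hx g) d hd
  funext b
  exact hd (j, b) (by simpa [abs_le] using hj)

theorem Influences.eq_iff (hnonab : ∀ b, ∃ g h : S b, g * h ≠ h * g)
    (hiso : ∀ a b, Nonempty (S a ≃* S b)) (hhom : ∀ c c', F (c * c') = F c * F c')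
    (hcont : Continuous[configTop (∀ b, S b), configTop (∀ b, S b)] F)
    {y z : ℤ × κ} (h : Influences F y z) (c c' : ℤ → ∀ b, S b) :
    F c z.1 z.2 = F c' z.1 z.2 ↔ c y.1 y.2 = c' y.1 y.2 := by
  have key : ∀ c : ℤ → ∀ b, S b, F c z.1 z.2 =
      cellHom F hhom z (Pi.mulSingle y (c y.1 y.2)) := by
    intro c
    have h1 := congrArg (cellHom F hhom z)
      (Pi.mulSingle_mul_update_one (fun x : ℤ × κ => c x.1 x.2) y)
    rw [map_mul, h.map_eq_one hnonab hiso hhom hcont (Function.update _ y 1) (by simp),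
      mul_one] at h1
    exact h1.symm
  rw [key c, key c']
  exact (bijective_of_influences hiso hhom h).1.eq_iff

/-- An injective group cellular automaton over a power of a non-abelian simple group permutes
the tracks, shifting each of them. -/
theorem exists_transports (hnonab : ∀ b, ∃ g h : S b, g * h ≠ h * g)
    (hiso : ∀ a b, Nonempty (S a ≃* S b)) (hhom : ∀ c c', F (c * c') = F c * F c')
    (hcont : Continuous[configTop (∀ b, S b), configTop (∀ b, S b)] F)
    (hshift : F ∘ shiftMap (∀ b, S b) = shiftMap (∀ b, S b) ∘ F)
    (hinj : Function.Injective F) :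
    ∃ (k : κ → ℤ) (β : Equiv.Perm κ) (E : Equiv.Perm (ℤ × κ)),
      (∀ i b, E (i, b) = (i + k b, β b)) ∧ (∀ y, Influences F y (E y)) ∧ Transports F E := by
  choose z hz using fun a : κ => exists_influences hhom hinj (0, a)
  have hinjβ : Function.Injective fun a => (z a).2 := by
    intro a a' haa
    have h1 := (hz a).translate hshift (-(z a).1)
    have h2 := (hz a').translate hshift (-(z a').1)
    simp only at haa
    rw [add_neg_cancel] at h1 h2
    rw [haa] at h1
    exact congrArg Prod.snd (h1.unique hnonab hiso hhom h2)
  let β : Equiv.Perm κ := Equiv.ofBijective _ (Finite.injective_iff_bijective.1 hinjβ)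
  let E : Equiv.Perm (ℤ × κ) :=
    { toFun := fun y => (y.1 + (z y.2).1, β y.2)
      invFun := fun y => (y.1 - (z (β.symm y.2)).1, β.symm y.2)
      left_inv := fun y => by simp
      right_inv := fun y => by simp }
  have hE : ∀ y, Influences F y (E y) := by
    rintro ⟨i, a⟩
    have := (hz a).translate hshift i
    rw [zero_add, add_comm] at this
    exact this
  exact ⟨fun a => (z a).1, β, E, fun _ _ => rfl, hE,
    fun c c' y => (hE y).eq_iff hnonab hiso hhom hcont c c'⟩

end Structure

/-- for an injective GCA on a direct product of pairwise isomorphic finite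
non-abelian simple groups, topological transitivity is equivalent to expansivity. -/
theorem transitive_iff_expansive_simple_product (m : ℕ) (S : Fin m → Type*)
    [∀ i, Group (S i)] [∀ i, Fintype (S i)]
    (hsimple : ∀ i, IsSimpleGroup (S i))
    (hnonab : ∀ i, ∃ a b : S i, a * b ≠ b * a)
    (hiso : ∀ i j, Nonempty (S i ≃* S j))
    (F : (ℤ → ∀ i, S i) → (ℤ → ∀ i, S i))
    (hcont : Continuous[configTop (∀ i, S i), configTop (∀ i, S i)] F)
    (hshift : F ∘ shiftMap (∀ i, S i) = shiftMap (∀ i, S i) ∘ F)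
    (hhom : ∀ c c' : ℤ → ∀ i, S i, F (c * c') = F c * F c')
    (hinj : Function.Injective F) :
    TopTransitive F ↔ Expansive F := by
  have hF1 : F 1 = 1 := by simpa using hhom 1 1
  obtain ⟨k, β, E, hk, hinf, hE⟩ := exists_transports hnonab hiso hhom hcont hshift hinj
  have hsurj := surjective_of_influences hiso hhom hinf hE
  obtain ⟨D, hD⟩ := exists_pow_eq_translation hk
  have hL : 0 < orderOf β := orderOf_pos β
  have hDL : ∀ i b, (E ^ orderOf β) (i, b) = (i + D (orderOf β) b, b) := by
    simpa [pow_orderOf_eq_one] using hD (orderOf β)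
  by_cases hne : ∀ b, D (orderOf β) b ≠ 0
  · exact iff_of_true (hE.topTransitive hsurj hDL hne) (hE.expansive hsurj hDL hne)
  · push Not at hne
    obtain ⟨b, hb⟩ := hne
    have hfix : ∀ i, (E ^ orderOf β) (i, b) = (i, b) := fun i => by rw [hDL, hb, add_zero]
    exact iff_of_false (hE.not_topTransitive hF1 hL (hfix 0))
      (hE.not_expansive hsurj hL hD hfix)
end

section
/- Let G be a finite group and let F be an injective group cellular automaton on G. If F is expansive, then F is topologically transitive. -/
open Function Topology

open Filter

section CompactGroupAutomorphism

variable {X : Type*} [Group X]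

/-- The points whose iterates under `φ` at all times in `[a, b]` lie in `N`. -/
def stayIn (φ : MulAut X) (N : Subgroup X) (a b : ℤ) : Subgroup X where
  carrier := {x | ∀ i, a ≤ i → i ≤ b → (φ ^ i) x ∈ N}
  one_mem' i _ _ := by simp
  mul_mem' hx hy i h₁ h₂ := by simpa using N.mul_mem (hx i h₁ h₂) (hy i h₁ h₂)
  inv_mem' hx i h₁ h₂ := by simpa using hx i h₁ h₂

/-- The points whose forward orbit under `φ` lies in `N`. -/
def stayInForever (φ : MulAut X) (N : Subgroup X) : Subgroup X where
  carrier := {x | ∀ i : ℤ, 0 ≤ i → (φ ^ i) x ∈ N}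
  one_mem' i _ := by simp
  mul_mem' hx hy i h := by simpa using N.mul_mem (hx i h) (hy i h)
  inv_mem' hx i h := by simpa using hx i h

theorem stayIn_anti (φ : MulAut X) (N : Subgroup X) {a b a' b' : ℤ} (ha : a ≤ a') (hb : b' ≤ b) :
    stayIn φ N a b ≤ stayIn φ N a' b' :=
  fun _ hx i h₁ h₂ => hx i (ha.trans h₁) (h₂.trans hb)

theorem zpow_mem_stayIn {φ : MulAut X} {N : Subgroup X} {a b : ℤ} {x : X}
    (hx : x ∈ stayIn φ N a b) (j : ℤ) : (φ ^ j) x ∈ stayIn φ N (a - j) (b - j) := by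
  intro i h₁ h₂
  rw [← MulAut.mul_apply, ← zpow_add]
  exact hx _ (by lia) (by lia)

instance stayIn_normal (φ : MulAut X) (N : Subgroup X) [hN : N.Normal] (a b : ℤ) :
    (stayIn φ N a b).Normal where
  conj_mem x hx g i h₁ h₂ := by
    simpa using hN.conj_mem _ (hx i h₁ h₂) ((φ ^ i) g)

variable [TopologicalSpace X] [IsTopologicalGroup X]

/-- The stable group of `φ`: the points whose forward orbit converges to `1`. -/
def stableSubgroup (φ : MulAut X) : Subgroup X where
  carrier := {x | Tendsto (fun n : ℕ => (φ ^ n) x) atTop (𝓝 1)}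
  one_mem' := by simpa using tendsto_const_nhds
  mul_mem' {x y} hx hy := by
    have h := Tendsto.mul hx hy
    simpa using h
  inv_mem' {x} hx := by
    have h := Tendsto.inv hx
    simpa using h

theorem mem_stableSubgroup {φ : MulAut X} {x : X} :
    x ∈ stableSubgroup φ ↔ Tendsto (fun n : ℕ => (φ ^ n) x) atTop (𝓝 1) := Iff.rfl

theorem map_mem_stableSubgroup {φ : MulAut X} {τ : X →* X} (hτ : Continuous τ)
    (hcomm : ∀ x, φ (τ x) = τ (φ x)) {x : X} (hx : x ∈ stableSubgroup φ) :
    τ x ∈ stableSubgroup φ := by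
  have h (n : ℕ) (y : X) : (φ ^ n) (τ y) = τ ((φ ^ n) y) := by
    induction n generalizing y with
    | zero => rfl
    | succ n ih => rw [pow_succ, MulAut.mul_apply, MulAut.mul_apply, hcomm, ih]
  rw [mem_stableSubgroup] at hx ⊢
  simp only [h]
  simpa [comp_def] using (hτ.tendsto 1).comp hx

omit [IsTopologicalGroup X] in
theorem continuous_mulAut_zpow {φ : MulAut X} (h₁ : Continuous φ) (h₂ : Continuous (φ⁻¹ : MulAut X))
    (j : ℤ) : Continuous (φ ^ j : MulAut X) := by
  have key (ψ : MulAut X) (hψ : Continuous ψ) (n : ℕ) : Continuous (ψ ^ n : MulAut X) := by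
    induction n with
    | zero => exact continuous_id
    | succ n ih => rw [pow_succ]; exact ih.comp hψ
  obtain ⟨n, rfl | rfl⟩ := j.eq_nat_or_neg
  · simpa using key φ h₁ n
  · simpa using key φ⁻¹ h₂ n

theorem zpow_mem_stableSubgroup {φ : MulAut X} (h₁ : Continuous φ)
    (h₂ : Continuous (φ⁻¹ : MulAut X)) (j : ℤ) {x : X} (hx : x ∈ stableSubgroup φ) :
    (φ ^ j) x ∈ stableSubgroup φ :=
  map_mem_stableSubgroup (τ := (φ ^ j).toMonoidHom) (continuous_mulAut_zpow h₁ h₂ j)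
    (fun y => by
      change φ ((φ ^ j) y) = (φ ^ j) (φ y)
      rw [← MulAut.mul_apply, ← MulAut.mul_apply, (Commute.self_zpow φ j).eq]) hx

omit [IsTopologicalGroup X] in
theorem isOpen_stayIn {φ : MulAut X} (h₁ : Continuous φ) (h₂ : Continuous (φ⁻¹ : MulAut X))
    {N : Subgroup X} (hN : IsOpen (N : Set X)) (a b : ℤ) :
    IsOpen (stayIn φ N a b : Set X) := by
  have h : (stayIn φ N a b : Set X) = ⋂ i ∈ Set.Icc a b, (φ ^ i : MulAut X) ⁻¹' N := by
    ext x
    simp [stayIn]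
  rw [h]
  exact (Set.finite_Icc a b).isOpen_biInter fun i _ => hN.preimage (continuous_mulAut_zpow h₁ h₂ i)

variable [CompactSpace X] {φ : MulAut X} (h₁ : Continuous φ) (h₂ : Continuous (φ⁻¹ : MulAut X))
  {N : Subgroup X} (hN : IsOpen (N : Set X))
include h₁ h₂ hN

theorem exists_stayIn_subset_of_forall {a b : ℕ → ℤ} (ha : Antitone a) (hb : Monotone b)
    {U : Set X} (hU : IsOpen U) (h : ∀ x, (∀ n, x ∈ stayIn φ N (a n) (b n)) → x ∈ U) :
    ∃ n, (stayIn φ N (a n) (b n) : Set X) ⊆ U := by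
  have hclosed (n : ℕ) : IsClosed (stayIn φ N (a n) (b n) : Set X) :=
    Subgroup.isClosed_of_isOpen _ (isOpen_stayIn h₁ h₂ hN _ _)
  refine exists_subset_nhds_of_isCompact' (V := fun n => (stayIn φ N (a n) (b n) : Set X))
    (Antitone.directed_ge fun m n hmn => stayIn_anti φ N (ha hmn) (hb hmn))
    (fun n => (hclosed n).isCompact) hclosed fun x hx => hU.mem_nhds (h x ?_)
  simpa using hx

variable (hexp : ∀ x, (∀ n : ℤ, (φ ^ n) x ∈ N) → x = 1)
include hexp

theorem exists_stayIn_subset_of_mem_nhds {U : Set X} (hU : U ∈ 𝓝 (1 : X)) :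
    ∃ n : ℕ, (stayIn φ N (-n) n : Set X) ⊆ U := by
  obtain ⟨V, hVU, hV, h1⟩ := mem_nhds_iff.1 hU
  obtain ⟨n, hn⟩ := exists_stayIn_subset_of_forall h₁ h₂ hN (a := fun n => -n) (b := fun n => n)
    (fun m n h => by simpa using h) (fun m n h => by simpa using h) hV (fun x hx => by
      rw [hexp x fun i => hx i.natAbs i (by lia) (by lia)]
      exact h1)
  exact ⟨n, hn.trans hVU⟩

theorem stayInForever_le_stableSubgroup : stayInForever φ N ≤ stableSubgroup φ := by
  intro x hx
  rw [mem_stableSubgroup, tendsto_def]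
  intro U hU
  obtain ⟨k, hk⟩ := exists_stayIn_subset_of_mem_nhds h₁ h₂ hN hexp hU
  filter_upwards [eventually_ge_atTop k] with n hn
  refine hk fun i hi₁ hi₂ => ?_
  beta_reduce
  rw [← zpow_natCast, ← MulAut.mul_apply, ← zpow_add]
  exact hx _ (by lia)

omit hexp in
theorem exists_stayIn_le_sup_stayInForever [N.Normal] :
    ∃ n : ℕ, ∀ m : ℤ, n ≤ m → stayIn φ N 0 m ≤ stayInForever φ N ⊔ stayIn φ N (-1) m := by
  obtain ⟨n, hn⟩ := exists_stayIn_subset_of_forall h₁ h₂ hN (a := fun _ => 0) (b := fun n => n)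
    (fun m n h => le_rfl) (fun m n h => by simpa using h)
    (U := (stayInForever φ N ⊔ stayIn φ N (-1) (-1) : Subgroup X))
    (Subgroup.isOpen_mono le_sup_right (isOpen_stayIn h₁ h₂ hN (-1) (-1)))
    (fun x hx => Subgroup.mem_sup_left fun i hi => hx i.natAbs i hi (by lia))
  refine ⟨n, fun m hm x hx => ?_⟩
  obtain ⟨a, ha, y, hy, rfl⟩ := Subgroup.mem_sup_of_normal_right.1
    (hn (stayIn_anti φ N le_rfl hm hx))
  refine Subgroup.mul_mem_sup ha fun i hi₁ hi₂ => ?_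
  rcases eq_or_lt_of_le hi₁ with rfl | hi
  · exact hy _ le_rfl le_rfl
  · have := N.mul_mem (N.inv_mem (ha i (by lia))) (hx i (by lia) hi₂)
    simpa using this

/-- For an expansive automorphism of a compact group, the closure of the stable group is open. -/
theorem isOpen_closure_stableSubgroup [N.Normal] :
    IsOpen ((stableSubgroup φ).topologicalClosure : Set X) := by
  obtain ⟨n, hn⟩ := exists_stayIn_le_sup_stayInForever h₁ h₂ hN
  set W := stableSubgroup φ with hW
  have hshift {a b : ℤ} (j : ℤ) {x : X} (hx : x ∈ W ⊔ stayIn φ N a b) :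
      (φ ^ j) x ∈ W ⊔ stayIn φ N (a - j) (b - j) := by
    obtain ⟨w, hw, y, hy, rfl⟩ := Subgroup.mem_sup_of_normal_right.1 hx
    rw [map_mul]
    exact Subgroup.mul_mem_sup (zpow_mem_stableSubgroup h₁ h₂ j hw) (zpow_mem_stayIn hy j)
  have hstep (j : ℕ) : stayIn φ N (-j) n ≤ W ⊔ stayIn φ N (-(j + 1)) n := by
    intro x hx
    have hx' := zpow_mem_stayIn hx (-j)
    have hle : stayInForever φ N ⊔ stayIn φ N (-1) (n + j) ≤ W ⊔ stayIn φ N (-1) (n + j) :=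
      sup_le_sup_right (stayInForever_le_stableSubgroup h₁ h₂ hN hexp) _
    have hx'' := hshift j (hle (hn (n + j) (by lia)
      (stayIn_anti φ N (by lia) (by lia) hx')))
    rw [← MulAut.mul_apply, ← zpow_add, add_neg_cancel, zpow_zero, MulAut.one_apply] at hx''
    exact sup_le_sup_left (stayIn_anti φ N (by lia) (by lia)) _ hx''
  have hpast (j : ℕ) : W ⊔ stayIn φ N 0 n ≤ W ⊔ stayIn φ N (-j) n := by
    induction j with
    | zero => simp
    | succ j ih =>
      refine ih.trans (sup_le le_sup_left ((hstep j).trans ?_))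
      push_cast
      exact le_rfl
  set M := W ⊔ stayIn φ N 0 n with hM
  have hMopen : IsOpen (M : Set X) :=
    Subgroup.isOpen_mono le_sup_right (isOpen_stayIn h₁ h₂ hN 0 n)
  have hMφ : M ≤ M.map φ.toMonoidHom := by
    intro x hx
    refine ⟨φ⁻¹ x, ?_, φ.apply_symm_apply x⟩
    have := hshift (-1) (hpast 1 hx)
    rw [zpow_neg_one] at this
    exact sup_le_sup_left (stayIn_anti φ N (by lia) (by lia)) _ this
  have hfin : M.index ≠ 0 := by
    have := Subgroup.quotient_finite_of_isOpen M hMopen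
    exact Subgroup.index_ne_zero_of_finite
  have hMφ' : M.map φ.toMonoidHom ≤ M := by
    have hidx : (M.map φ.toMonoidHom).index = M.index := Subgroup.index_map_equiv M φ
    have hrel := Subgroup.relIndex_mul_index hMφ
    rw [hidx] at hrel
    exact Subgroup.relIndex_eq_one.1 (Nat.eq_of_mul_eq_mul_right (Nat.pos_of_ne_zero hfin)
      (by rw [hrel, one_mul]))
  have hMpow (j : ℕ) {x : X} (hx : x ∈ M) : (φ ^ j) x ∈ M := by
    induction j with
    | zero => exact hx
    | succ j ih => rw [pow_succ', MulAut.mul_apply]; exact hMφ' ⟨_, ih, rfl⟩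
  refine Subgroup.isOpen_mono (H₁ := stayIn φ N 0 n) (fun x hx => ?_)
    (isOpen_stayIn h₁ h₂ hN 0 n)
  change x ∈ closure (W : Set X)
  rw [mem_closure_iff_nhds]
  intro U hU
  have hU' : (fun y => x * y⁻¹) ⁻¹' U ∈ 𝓝 (1 : X) :=
    ContinuousAt.preimage_mem_nhds (by fun_prop) (by simpa using hU)
  obtain ⟨j, hj⟩ := exists_stayIn_subset_of_mem_nhds h₁ h₂ hN hexp hU'
  have hy := hshift (-j) (hpast (2 * j) (hMpow j (Subgroup.mem_sup_right hx)))
  rw [← zpow_natCast, ← MulAut.mul_apply, ← zpow_add, neg_add_cancel, zpow_zero,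
    MulAut.one_apply] at hy
  obtain ⟨w, hw, y, hy, hwy⟩ := Subgroup.mem_sup_of_normal_right.1
    (sup_le_sup_left (stayIn_anti φ N (a' := -j) (b' := j) (by lia) (by lia)) _ hy)
  refine ⟨w, ?_, hw⟩
  have := hj hy
  rwa [Set.mem_preimage, ← hwy, mul_inv_cancel_right] at this

end CompactGroupAutomorphism

theorem exists_image_inter_nonempty_of_dense_stableSubgroup {X : Type*} [Group X]
    [TopologicalSpace X] [IsTopologicalGroup X] {φ : MulAut X}
    (hs : Dense (stableSubgroup φ : Set X)) (hu : Dense (stableSubgroup φ⁻¹ : Set X))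
    {U V : Set X} (hU : IsOpen U) (hV : IsOpen V) (hU' : U.Nonempty) (hV' : V.Nonempty) :
    ∃ n : ℕ, ((φ ^ n : MulAut X) '' U ∩ V).Nonempty := by
  obtain ⟨a, haU, ha⟩ := hs.inter_open_nonempty U hU hU'
  obtain ⟨b, hbV, hb⟩ := hu.inter_open_nonempty V hV hV'
  have hlim₁ : Tendsto (fun n : ℕ => a * (φ⁻¹ ^ n) b) atTop (𝓝 a) := by
    simpa using (mem_stableSubgroup.1 hb).const_mul a
  have hlim₂ : Tendsto (fun n : ℕ => (φ ^ n) a * b) atTop (𝓝 b) := by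
    simpa using (mem_stableSubgroup.1 ha).mul_const b
  obtain ⟨n, hn₁, hn₂⟩ := ((hlim₁.eventually (hU.mem_nhds haU)).and
    (hlim₂.eventually (hV.mem_nhds hbV))).exists
  refine ⟨n, _, ⟨_, hn₁, rfl⟩, ?_⟩
  rw [map_mul, ← MulAut.mul_apply, inv_pow, mul_inv_cancel, MulAut.one_apply]
  exact hn₂

section Configurations

variable {A : Type*}

theorem iterate_shiftMap_apply (k : ℕ) (c : ℤ → A) (i : ℤ) :
    (shiftMap A)^[k] c i = c (i + k) := by
  induction k generalizing i with
  | zero => simp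
  | succ k ih =>
    rw [iterate_succ_apply', shiftMap, ih]
    congr 1
    push_cast
    ring

theorem finite_fixed_iterate_shiftMap [Finite A] {p : ℕ} (hp : p ≠ 0) :
    {c : ℤ → A | (shiftMap A)^[p] c = c}.Finite := by
  have : NeZero p := ⟨hp⟩
  refine Set.Finite.subset (Set.finite_range fun (d : ZMod p → A) (i : ℤ) => d i) fun c hc => ?_
  have hper : Function.Periodic c (p : ℤ) := fun i => by
    rw [← iterate_shiftMap_apply p c i, hc]
  refine ⟨fun z => c z.val, funext fun i => ?_⟩
  change c ((i : ZMod p).val : ℤ) = c i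
  rw [ZMod.val_intCast, Int.emod_def, mul_comm]
  exact hper.sub_int_mul_eq _

variable [TopologicalSpace A]

/-- The open sets of configurations contain cylinders around each of their points. -/
theorem exists_cylinder_subset {U : Set (ℤ → A)} (hU : IsOpen U) {c : ℤ → A} (hc : c ∈ U) :
    ∃ m : ℕ, ∀ d : ℤ → A, (∀ i : ℤ, i.natAbs ≤ m → d i = c i) → d ∈ U := by
  obtain ⟨I, u, hu, hIU⟩ := isOpen_pi_iff.1 hU c hc
  refine ⟨I.sup Int.natAbs, fun d hd => hIU fun i hi => ?_⟩
  rw [hd i (Finset.le_sup (f := Int.natAbs) hi)]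
  exact (hu i hi).2

/-- Injective cellular automata are surjective. -/
theorem surjective_of_injective_of_shift_comm [DiscreteTopology A] [Finite A]
    {F : (ℤ → A) → (ℤ → A)}
    (hcont : Continuous F) (hshift : Function.Commute F (shiftMap A)) (hinj : Injective F) :
    Surjective F := by
  have hclosed : IsClosed (Set.range F) := (isCompact_range hcont).isClosed
  rw [← Set.range_eq_univ, ← hclosed.closure_eq]
  refine Dense.closure_eq (dense_iff_inter_open.2 fun U hU ⟨c, hc⟩ => ?_)
  obtain ⟨m, hm⟩ := exists_cylinder_subset hU hc
  set p : ℕ := 2 * m + 1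
  set S := {c : ℤ → A | (shiftMap A)^[p] c = c}
  have hmaps : Set.MapsTo F S S := fun d hd => by
    change (shiftMap A)^[p] (F d) = F d
    rw [← (hshift.iterate_right p).eq, hd]
  have hsurj : Set.SurjOn F S S := by
    have hS : S.Finite := finite_fixed_iterate_shiftMap (by lia)
    exact (hS.injOn_iff_bijOn_of_mapsTo hmaps).1 hinj.injOn |>.surjOn
  let d : ℤ → A := fun i => c ((i + m) % p - m)
  have hd : d ∈ S := funext fun i => by
    rw [iterate_shiftMap_apply]
    change c ((i + p + m) % p - m) = c ((i + m) % p - m)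
    rw [show i + p + m = i + m + p by ring, Int.add_emod_right]
  obtain ⟨e, -, he⟩ := hsurj hd
  refine ⟨d, hm d fun i hi => ?_, e, he⟩
  change c ((i + m) % p - m) = c i
  rw [Int.emod_eq_of_lt (by lia) (by lia), add_sub_cancel_right]

end Configurations

section GroupConfigurations

variable {G : Type*} [Group G]

/-- The configurations that are trivial on `[-m, m]`. -/
def trivialNearZero (G : Type*) [Group G] (m : ℕ) : Subgroup (ℤ → G) where
  carrier := {c | ∀ i : ℤ, i.natAbs ≤ m → c i = 1}
  one_mem' _ _ := rfl
  mul_mem' hx hy i hi := by simp [hx i hi, hy i hi]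
  inv_mem' hx i hi := by simp [hx i hi]

instance trivialNearZero_normal (m : ℕ) : (trivialNearZero G m).Normal where
  conj_mem c hc g i hi := by simp [hc i hi]

theorem tychDist_one_le_of_mem_trivialNearZero {m : ℕ} {c : ℤ → G}
    (hc : c ∈ trivialNearZero G m) : tychDist c 1 ≤ (2 : ℝ)⁻¹ ^ m := by
  unfold tychDist
  split_ifs with h
  · positivity
  · rw [zpow_neg, zpow_natCast, ← inv_pow]
    refine pow_le_pow_of_le_one (by norm_num) (by norm_num) ?_
    obtain ⟨j, hj⟩ := Function.ne_iff.1 h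
    refine le_csInf ⟨_, j, rfl, hj⟩ ?_
    rintro n ⟨i, rfl, hi⟩
    by_contra! hlt
    exact hi (hc i hlt.le)

variable [TopologicalSpace G] [DiscreteTopology G]

theorem isOpen_trivialNearZero (m : ℕ) : IsOpen (trivialNearZero G m : Set (ℤ → G)) := by
  have h : (trivialNearZero G m : Set (ℤ → G)) =
      (Set.Icc (-m : ℤ) m).pi fun _ => ({1} : Set G) := by
    ext c
    simp only [trivialNearZero, Set.mem_pi, Set.mem_Icc, Set.mem_singleton_iff]
    exact forall_congr' fun i => imp_congr_left (by lia)
  rw [h]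
  exact isOpen_set_pi (Set.finite_Icc _ _) fun _ _ => isOpen_discrete _

omit [DiscreteTopology G] in
/-- A shift-invariant open subgroup of the configurations is everything. -/
theorem eq_top_of_isOpen_of_shiftMap_mem {H : Subgroup (ℤ → G)}
    (hH : IsOpen (H : Set (ℤ → G))) (hshift : ∀ c ∈ H, shiftMap G c ∈ H) : H = ⊤ := by
  obtain ⟨m, hm⟩ := exists_cylinder_subset hH H.one_mem
  have hiter (k : ℕ) {c : ℤ → G} (hc : c ∈ H) : (shiftMap G)^[k] c ∈ H := by
    induction k with
    | zero => exact hc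
    | succ k ih => rw [iterate_succ_apply']; exact hshift _ ih
  refine (Subgroup.eq_top_iff' H).2 fun x => ?_
  let y : ℤ → G := fun i => if i.natAbs ≤ m then 1 else x i
  let z : ℤ → G := fun i =>
    if (i - (2 * m + 1)).natAbs ≤ m then x (i - (2 * m + 1)) else 1
  have hyz : x = y * (shiftMap G)^[2 * m + 1] z := funext fun i => by
    simp only [Pi.mul_apply, iterate_shiftMap_apply, y, z]
    push_cast
    rw [add_sub_cancel_right]
    split_ifs <;> simp
  rw [hyz]
  exact H.mul_mem (hm y fun i hi => if_pos hi)
    (hiter _ (hm z fun i hi => if_neg (by lia)))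

theorem dense_stableSubgroup [Finite G] {φ : MulAut (ℤ → G)} (h₁ : Continuous φ)
    (h₂ : Continuous (φ⁻¹ : MulAut (ℤ → G))) (hshift : ∀ c, φ (shiftMap G c) = shiftMap G (φ c))
    {m : ℕ} (hexp : ∀ c, (∀ n : ℤ, (φ ^ n) c ∈ trivialNearZero G m) → c = 1) :
    Dense (stableSubgroup φ : Set (ℤ → G)) := by
  have hcont : Continuous (shiftMap G) := continuous_pi fun i => continuous_apply (i + 1)
  let τ : (ℤ → G) →* (ℤ → G) :=
    { toFun := shiftMap G, map_one' := rfl, map_mul' := fun _ _ => rfl }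
  have htop := eq_top_of_isOpen_of_shiftMap_mem
    (isOpen_closure_stableSubgroup h₁ h₂ (isOpen_trivialNearZero m) hexp)
    (fun c hc => map_mem_closure hcont hc fun d hd =>
      map_mem_stableSubgroup (τ := τ) hcont hshift hd)
  intro c
  have : c ∈ (stableSubgroup φ).topologicalClosure := htop ▸ Subgroup.mem_top c
  exact this

end GroupConfigurations

/-- expansive injective GCAs are topologically transitive. -/
theorem topTransitive_of_expansive {G : Type*} [Group G] [Fintype G]
    (F : (ℤ → G) → (ℤ → G))
    (hcont : Continuous[configTop G, configTop G] F)
    (hshift : F ∘ shiftMap G = shiftMap G ∘ F)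
    (hhom : ∀ c c' : ℤ → G, F (c * c') = F c * F c')
    (hinj : Function.Injective F)
    (hexp : Expansive F) :
    TopTransitive F := by
  let _ : TopologicalSpace G := ⊥
  have : DiscreteTopology G := ⟨rfl⟩
  have hcont' : Continuous F := hcont
  have hcomm : Function.Commute F (shiftMap G) := fun c => congrFun hshift c
  have hbij : Bijective F := ⟨hinj, surjective_of_injective_of_shift_comm hcont' hcomm hinj⟩
  let φ : MulAut (ℤ → G) := MulEquiv.ofBijective (MonoidHom.mk' F hhom) hbij
  have h₂ : Continuous (φ⁻¹ : MulAut (ℤ → G)) :=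
    (hcont'.homeoOfEquivCompactToT2 (f := φ.toEquiv)).symm.continuous
  have hφinv (c : ℤ → G) : invFun F c = φ⁻¹ c :=
    hinj ((invFun_eq (hbij.2 c)).trans (φ.apply_symm_apply c).symm)
  have hpow (ψ : MulAut (ℤ → G)) (n : ℕ) : (ψ ^ n : MulAut (ℤ → G)) = (ψ : _ → _)^[n] := by
    induction n with
    | zero => rfl
    | succ n ih => rw [pow_succ, iterate_succ, ← ih]; rfl
  have hz (n : ℤ) (c : ℤ → G) : zIter F n c = (φ ^ n) c := by
    unfold zIter
    split_ifs with hn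
    · lift n to ℕ using hn
      rw [zpow_natCast, hpow]
      rfl
    · obtain ⟨k, rfl⟩ : ∃ k : ℕ, n = -k := ⟨n.natAbs, by lia⟩
      rw [zpow_neg, zpow_natCast, ← inv_pow, hpow, funext hφinv]
      simp
  obtain ⟨ε, hε, hexp⟩ := hexp
  obtain ⟨m, hm⟩ := exists_pow_lt_of_lt_one hε (show (2 : ℝ)⁻¹ < 1 by norm_num)
  have hexp' (c : ℤ → G) (hc : ∀ n : ℤ, (φ ^ n) c ∈ trivialNearZero G m) : c = 1 := by
    by_contra hne
    obtain ⟨n, hn⟩ := hexp c 1 hne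
    rw [hz, hz, map_one] at hn
    exact absurd (tychDist_one_le_of_mem_trivialNearZero (hc n)) (by linarith)
  have hs : Dense (stableSubgroup φ : Set (ℤ → G)) :=
    dense_stableSubgroup hcont' h₂ hcomm hexp'
  have hu : Dense (stableSubgroup φ⁻¹ : Set (ℤ → G)) := by
    refine dense_stableSubgroup (m := m) h₂ (by rwa [inv_inv]) (fun c => hinj ?_)
      (fun c hc => hexp' c fun n => by simpa using hc (-n))
    rw [hcomm.eq]
    change φ (φ⁻¹ _) = shiftMap G (φ (φ⁻¹ c))
    simp only [MulAut.apply_inv_self]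
  intro U V hU hV hU' hV'
  obtain ⟨n, hn⟩ := exists_image_inter_nonempty_of_dense_stableSubgroup hs hu hU hV hU' hV'
  rw [hpow] at hn
  exact ⟨n, hn⟩
end
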